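/- arXiv:1908.06157 — 5 statements merged into one kernel-verified Lean document; each statement's English description precedes it below -/
import Mathlib

section
/- Let α ∈ (0,1) be irrational and let B_k be the k-th matrix of the Minkowski chain for α (the case n = 1). If B_k = [[q, -p], [q', -p']], then the k-th pair of the Hurwitz chain of α is either (p/q, p'/q') or (p'/q', p/q). -/
/-- ξ(r) = p + α₁q₁ + ⋯ + αₙqₙ for r = (q₁, …, qₙ, p) ∈ ℤ^(n+1). -/
noncomputable def xi {n : ℕ} (α : Fin n → ℝ) (r : Fin (n + 1) → ℤ) : ℝ :=
  (r (Fin.last n) : ℝ) + ∑ i : Fin n, α i * (r (Fin.castSucc i) : ℝ)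

/-- The real span of the rows of `A` preceding row `j`. -/
def earlierRowSpan {n : ℕ} (A : Matrix (Fin (n + 1)) (Fin (n + 1)) ℤ) (j : Fin (n + 1)) :
    Submodule ℝ (Fin (n + 1) → ℝ) :=
  Submodule.span ℝ {x : Fin (n + 1) → ℝ | ∃ i : Fin (n + 1), i < j ∧ x = fun k => (A i k : ℝ)}

/-- `A` is the matrix produced by the Minkowski algorithm at stage `m`: each row has sup norm
at most `m`, is linearly independent of the previous rows, minimizes `|ξ|` among all integer
vectors with sup norm at most `m` that are linearly independent of the previous rows, and its
first nonzero entry is positive. -/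
def IsMinkowskiMatrix {n : ℕ} (α : Fin n → ℝ) (m : ℕ)
    (A : Matrix (Fin (n + 1)) (Fin (n + 1)) ℤ) : Prop :=
  ∀ j : Fin (n + 1),
    (∀ k, |A j k| ≤ (m : ℤ)) ∧
    (fun k => (A j k : ℝ)) ∉ earlierRowSpan A j ∧
    (∀ w : Fin (n + 1) → ℤ, (∀ k, |w k| ≤ (m : ℤ)) →
      ((fun k => (w k : ℝ)) ∉ earlierRowSpan A j) → |xi α (A j)| ≤ |xi α w|) ∧
    (∃ k₀ : Fin (n + 1), 0 < A j k₀ ∧ ∀ k < k₀, A j k = 0)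

/-- `B` (indexed from 0, so `B 0 = B₁`) is the Minkowski chain of `α`: the subsequence of
distinct matrices among the matrices `A m` produced by the Minkowski algorithm, starting
with `A 1`. -/
def IsMinkowskiChain {n : ℕ} (α : Fin n → ℝ)
    (B : ℕ → Matrix (Fin (n + 1)) (Fin (n + 1)) ℤ) : Prop :=
  ∃ (A : ℕ → Matrix (Fin (n + 1)) (Fin (n + 1)) ℤ) (idx : ℕ → ℕ),
    (∀ m, 1 ≤ m → IsMinkowskiMatrix α m (A m)) ∧
    StrictMono idx ∧ idx 0 = 1 ∧
    (∀ k, B k = A (idx k)) ∧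
    (∀ k m, idx k ≤ m → m < idx (k + 1) → A m = A (idx k)) ∧
    (∀ k, A (idx (k + 1)) ≠ A (idx k))
/-- `x < y` are consecutive elements of the `m`-th Farey set `F_m` (rationals in `[0,1]`
with denominator at most `m`). -/
def IsFareyPair (m : ℕ) (x y : ℚ) : Prop :=
  x < y ∧ 0 ≤ x ∧ y ≤ 1 ∧ x.den ≤ m ∧ y.den ≤ m ∧
    ∀ z : ℚ, 0 ≤ z → z ≤ 1 → z.den ≤ m → ¬(x < z ∧ z < y)

/-- `P` is the pair of consecutive Farey fractions of level `m` surrounding `α`. -/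
def IsSurroundingFareyPair (α : ℝ) (m : ℕ) (P : ℚ × ℚ) : Prop :=
  IsFareyPair m P.1 P.2 ∧ (P.1 : ℝ) < α ∧ α < (P.2 : ℝ)

/-- `H` (indexed from 0, so `H 0` is the first pair) is the Hurwitz chain of `α`: the
sequence of distinct pairs of surrounding Farey fractions as the level `m = 1, 2, …`
increases. -/
def IsHurwitzChain (α : ℝ) (H : ℕ → ℚ × ℚ) : Prop :=
  ∃ (f : ℕ → ℚ × ℚ) (idx : ℕ → ℕ),
    (∀ m, 1 ≤ m → IsSurroundingFareyPair α m (f m)) ∧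
    StrictMono idx ∧ idx 0 = 1 ∧
    (∀ k, H k = f (idx k)) ∧
    (∀ k m, idx k ≤ m → m < idx (k + 1) → f m = f (idx k)) ∧
    (∀ k, f (idx (k + 1)) ≠ f (idx k))

/-- Around an irrational `α ∈ (0,1)` there is at every level `m ≥ 1` a unimodular pair of fractions
`p/q < α < p'/q'` whose mediant has denominator exceeding `m`. -/
theorem exists_unimodular_pair {α : ℝ} (hirr : Irrational α) (h0 : 0 < α) (h1 : α < 1)
    {m : ℕ} (hm : 1 ≤ m) :
    ∃ p q p' q' : ℤ, 0 ≤ p ∧ p' ≤ q' ∧ 0 < q ∧ q ≤ m ∧ 0 < q' ∧ q' ≤ m ∧ (m : ℤ) < q + q' ∧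
      p' * q - p * q' = 1 ∧ (p : ℝ) < q * α ∧ q' * α < p' := by
  induction m, hm using Nat.le_induction with
  | base => exact ⟨0, 1, 1, 1, by simp [h0, h1]⟩
  | succ m hm ih =>
    obtain ⟨p, q, p', q', hp, hp', hq, hqm, hq', hqm', hlt, hdet, hl, hr⟩ := ih
    by_cases hmed : (m : ℤ) + 1 < q + q'
    · exact ⟨p, q, p', q', hp, hp', hq, by push_cast; omega, hq', by push_cast; omega,
        by push_cast; omega, hdet, hl, hr⟩
    · have hne : ((q + q' : ℤ) : ℝ) * α ≠ ((p + p' : ℤ) : ℝ) :=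
        (hirr.intCast_mul (by omega)).ne_int _
      rcases lt_or_gt_of_ne hne with h | h
      · exact ⟨p, q, p + p', q + q', hp, by
          have : (p : ℝ) < q := by
            have : (0 : ℝ) < q := by exact_mod_cast hq
            nlinarith
          have : p < q := by exact_mod_cast this
          omega, hq, by push_cast; omega, by omega, by push_cast; omega,
          by push_cast; omega, by linear_combination hdet, hl, h⟩
      · exact ⟨p + p', q + q', p', q', by
          have : (0 : ℝ) < p' := by
            have : (0 : ℝ) < q' := by exact_mod_cast hq'
            nlinarith
          have : 0 < p' := by exact_mod_cast this
          omega, hp', by omega, by push_cast; omega, hq', by push_cast; omega,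
          by push_cast; omega, by linear_combination hdet, h, hr⟩

/-- A rational strictly between the members of a unimodular pair has denominator at least that
of their mediant. -/
theorem add_le_den_of_between {p q p' q' : ℤ} (hq : 0 < q) (hq' : 0 < q')
    (hdet : p' * q - p * q' = 1) {z : ℚ} (hl : (p : ℚ) / q < z) (hr : z < (p' : ℚ) / q') :
    q + q' ≤ z.den := by
  have hd : (0 : ℚ) < z.den := by exact_mod_cast z.den_pos
  rw [← Rat.num_div_den z, div_lt_div_iff₀ (by exact_mod_cast hq) hd] at hl
  rw [← Rat.num_div_den z, div_lt_div_iff₀ hd (by exact_mod_cast hq')] at hr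
  have hl : p * z.den < z.num * q := by exact_mod_cast hl
  have hr : z.num * q' < p' * z.den := by exact_mod_cast hr
  have : (z.den : ℤ) = q' * (z.num * q - p * z.den) + q * (p' * z.den - z.num * q') := by
    linear_combination -(z.den : ℤ) * hdet
  nlinarith

theorem Rat.num_lt_den_mul {x : ℚ} {α : ℝ} (h : (x : ℝ) < α) : (x.num : ℝ) < x.den * α := by
  have hd : (0 : ℝ) < x.den := by exact_mod_cast x.den_pos
  rwa [Rat.cast_def, div_lt_iff₀ hd, mul_comm] at h

theorem Rat.den_mul_lt_num {x : ℚ} {α : ℝ} (h : α < (x : ℝ)) : x.den * α < (x.num : ℝ) := by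
  have hd : (0 : ℝ) < x.den := by exact_mod_cast x.den_pos
  rwa [Rat.cast_def, lt_div_iff₀ hd, mul_comm] at h

/-- The Farey fractions surrounding an irrational number form a unimodular pair, and their
mediant does not belong to the Farey set. -/
theorem IsSurroundingFareyPair.unimodular {α : ℝ} (hirr : Irrational α) (h0 : 0 < α) (h1 : α < 1)
    {m : ℕ} (hm : 1 ≤ m) {P : ℚ × ℚ} (hP : IsSurroundingFareyPair α m P) :
    P.2.num * P.1.den - P.1.num * P.2.den = 1 ∧ m < P.1.den + P.2.den := by
  obtain ⟨p, q, p', q', hp, hp', hq, hqm, hq', hqm', hlt, hdet, hl, hr⟩ :=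
    exists_unimodular_pair hirr h0 h1 hm
  obtain ⟨⟨-, hx0, hy1, hxm, hym, hno⟩, hxα, hαy⟩ := hP
  have hqR : (0 : ℝ) < q := by exact_mod_cast hq
  have hqR' : (0 : ℝ) < q' := by exact_mod_cast hq'
  have hqQ : (0 : ℚ) < q := by exact_mod_cast hq
  have hqQ' : (0 : ℚ) < q' := by exact_mod_cast hq'
  have hlα : (((p : ℚ) / q : ℚ) : ℝ) < α := by
    push_cast; rw [div_lt_iff₀ hqR]; linarith
  have hαr : α < (((p' : ℚ) / q' : ℚ) : ℝ) := by
    push_cast; rw [lt_div_iff₀ hqR']; linarith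
  have hc : p.natAbs.Coprime q.natAbs := by
    rw [← Int.isCoprime_iff_nat_coprime]; exact ⟨-q', p', by linear_combination hdet⟩
  have hc' : p'.natAbs.Coprime q'.natAbs := by
    rw [← Int.isCoprime_iff_nat_coprime]; exact ⟨q, -p, by linear_combination hdet⟩
  have hden := Rat.den_div_eq_of_coprime hq hc
  have hden' := Rat.den_div_eq_of_coprime hq' hc'
  have hnum := Rat.num_div_eq_of_coprime hq hc
  have hnum' := Rat.num_div_eq_of_coprime hq' hc'
  have hx : P.1 = (p : ℚ) / q := by
    rcases lt_trichotomy P.1 ((p : ℚ) / q) with h | h | h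
    · refine absurd ⟨h, ?_⟩ (hno _ (by positivity) ?_ (by omega))
      · exact_mod_cast (hlα.trans h1).le
      · exact_mod_cast hlα.trans hαy
    · exact h
    · have := add_le_den_of_between hq hq' hdet h (by exact_mod_cast hxα.trans hαr)
      omega
  have hy : P.2 = (p' : ℚ) / q' := by
    rcases lt_trichotomy P.2 ((p' : ℚ) / q') with h | h | h
    · have := add_le_den_of_between hq hq' hdet (by exact_mod_cast hlα.trans hαy) h
      omega
    · exact h
    · refine absurd ⟨?_, h⟩ (hno _ ?_ ?_ (by omega))
      · exact_mod_cast (h0.trans hαr).le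
      · rw [div_le_one hqQ']; exact_mod_cast hp'
      · exact_mod_cast hxα.trans hαr
  rw [hx, hy, hnum, hnum', hden, hden']
  exact ⟨hdet, by omega⟩

theorem xi_one (α : ℝ) (r : Fin 2 → ℤ) : xi (fun _ : Fin 1 => α) r = r 1 + α * r 0 := by
  simp [xi]

theorem mem_earlierRowSpan_zero (A : Matrix (Fin 2) (Fin 2) ℤ) (x : Fin 2 → ℝ) :
    x ∈ earlierRowSpan A 0 ↔ x = 0 := by
  simp [earlierRowSpan]

theorem mem_earlierRowSpan_one (A : Matrix (Fin 2) (Fin 2) ℤ) (x : Fin 2 → ℝ) :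
    x ∈ earlierRowSpan A 1 ↔ ∃ c : ℝ, c * A 0 0 = x 0 ∧ c * A 0 1 = x 1 := by
  have : {x : Fin 2 → ℝ | ∃ i : Fin 2, i < 1 ∧ x = fun k => (A i k : ℝ)} =
      {fun k => (A 0 k : ℝ)} := by
    ext y
    simp
  rw [earlierRowSpan]
  erw [this]
  simp [Submodule.mem_span_singleton, funext_iff, Fin.forall_fin_two]

/-- If the integer coefficients `a`, `b` do not have the same strict sign and `b ≠ 0`, then the
combination `a s - b t` of positive reals is at most `t` in absolute value only if it is `±t`. -/
theorem coeff_eq_of_abs_le {a b : ℤ} {s t : ℝ} (hs : 0 < s) (ht : 0 < t) (hab : a * b ≤ 0)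
    (hb : b ≠ 0) (h : |a * s - b * t| ≤ t) : a = 0 ∧ (b = 1 ∨ b = -1) := by
  rw [abs_le] at h
  rcases lt_or_gt_of_ne hb with hb | hb
  · have ha : 0 ≤ a := by nlinarith
    have ha' : (0 : ℝ) ≤ a := by exact_mod_cast ha
    have hb1 : (b : ℝ) ≤ -1 := by exact_mod_cast (by omega : b ≤ -1)
    have has : (a : ℝ) * s ≤ 0 := by nlinarith
    have ha0 : (a : ℝ) ≤ 0 := by by_contra hc; nlinarith [mul_pos (not_le.1 hc) hs]
    have hbge : (-1 : ℝ) ≤ b := by by_contra hc; nlinarith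
    have ha0 : a ≤ 0 := by exact_mod_cast ha0
    have hbge : -1 ≤ b := by exact_mod_cast hbge
    omega
  · have ha : a ≤ 0 := by nlinarith
    have ha' : (a : ℝ) ≤ 0 := by exact_mod_cast ha
    have hb1 : (1 : ℝ) ≤ b := by exact_mod_cast (by omega : 1 ≤ b)
    have has : 0 ≤ (a : ℝ) * s := by nlinarith
    have ha0 : (0 : ℝ) ≤ a := by by_contra hc; nlinarith [mul_neg_of_neg_of_pos (not_le.1 hc) hs]
    have hble : (b : ℝ) ≤ 1 := by by_contra hc; nlinarith
    have ha0 : 0 ≤ a := by exact_mod_cast ha0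
    have hble : b ≤ 1 := by exact_mod_cast hble
    omega

/-- Among integer vectors of first coordinate at most `m` that are not multiples of `(q, -p)`, the
vector `(q', -p')` is the only minimizer of `|ξ|` with positive leading entry. -/
theorem eq_of_abs_xi_le {α : ℝ} {m : ℕ} {p q p' q' ε : ℤ} (hε : ε * ε = 1) (hq : 0 < q)
    (hq' : 0 < q') (hlt : (m : ℤ) < q + q') (hdet : p' * q - p * q' = ε)
    (hs : 0 < ε * (q * α - p)) (ht : 0 < ε * (p' - q' * α)) {w : Fin 2 → ℤ} (hw : |w 0| ≤ m)
    (hne : p * w 0 + q * w 1 ≠ 0) (hpos : ∃ k₀, 0 < w k₀ ∧ ∀ k < k₀, w k = 0)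
    (hmin : |xi (fun _ : Fin 1 => α) w| ≤ |xi (fun _ : Fin 1 => α) ![q', -p']|) :
    w 0 = q' ∧ w 1 = -p' := by
  obtain ⟨a, ha⟩ : ∃ a, a = ε * (p' * w 0 + q' * w 1) := ⟨_, rfl⟩
  obtain ⟨b, hb⟩ : ∃ b, b = -ε * (p * w 0 + q * w 1) := ⟨_, rfl⟩
  have hw0 : w 0 = a * q + b * q' := by
    rw [ha, hb]; linear_combination -(w 0) * hε - ε * w 0 * hdet
  have hw1 : w 1 = -(a * p + b * p') := by
    rw [ha, hb]; linear_combination -(w 1) * hε - ε * w 1 * hdet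
  have hb0 : b ≠ 0 := by
    have hε0 : ε ≠ 0 := by rintro rfl; simp at hε
    rw [hb]; exact mul_ne_zero (neg_ne_zero.2 hε0) hne
  have hεR : (ε : ℝ) * ε = 1 := by exact_mod_cast hε
  have hεabs : |(ε : ℝ)| = 1 := by
    rcases mul_self_eq_one_iff.1 hεR with h | h <;> simp [h]
  have hab : a * b ≤ 0 := by
    by_contra! h
    rw [abs_le] at hw
    rcases pos_and_pos_or_neg_and_neg_of_mul_pos h with ⟨h1, h2⟩ | ⟨h1, h2⟩ <;> nlinarith
  have hmin' : |a * (ε * (q * α - p)) - b * (ε * (p' - q' * α))| ≤ ε * (p' - q' * α) := by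
    calc |a * (ε * (q * α - p)) - b * (ε * (p' - q' * α))|
        = |ε * xi (fun _ : Fin 1 => α) w| := by
          rw [xi_one, hw0, hw1]; push_cast; ring_nf
      _ = |xi (fun _ : Fin 1 => α) w| := by rw [abs_mul, hεabs, one_mul]
      _ ≤ _ := hmin
      _ = |-(ε * xi (fun _ : Fin 1 => α) ![q', -p'])| := by
          rw [abs_neg, abs_mul, hεabs, one_mul]
      _ = |ε * (p' - q' * α)| := by
          rw [xi_one]
          simp only [Matrix.cons_val_zero, Matrix.cons_val_one]
          push_cast
          ring_nf
      _ = _ := abs_of_pos ht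
  obtain ⟨ha0, hb1⟩ := coeff_eq_of_abs_le hs ht hab hb0 hmin'
  have hw0' : 0 < w 0 := by
    obtain ⟨k₀, hk, hk'⟩ := hpos
    fin_cases k₀
    · exact hk
    · have h := hk' 0 (by simp)
      rcases hb1 with hb1 | hb1 <;> simp [hw0, ha0, hb1] at h <;> omega
  rcases hb1 with hb1 | hb1
  · simp [hw0, hw1, ha0, hb1]
  · simp [hw0, ha0, hb1] at hw0'; omega

theorem notMem_earlierRowSpan_one_of_det {A : Matrix (Fin 2) (Fin 2) ℤ} {w : Fin 2 → ℤ}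
    (h : A 0 0 * w 1 ≠ A 0 1 * w 0) : (fun k => (w k : ℝ)) ∉ earlierRowSpan A 1 := by
  rw [mem_earlierRowSpan_one]
  rintro ⟨c, h0, h1⟩
  apply h
  have : (A 0 0 * w 1 : ℝ) = A 0 1 * w 0 := by rw [← h0, ← h1]; ring
  exact_mod_cast this

/-- A Minkowski matrix whose first row is not a multiple of one member of a unimodular pair
consists of the two members of that pair. -/
theorem IsMinkowskiMatrix.eq_of_unimodular {α : ℝ} {m : ℕ} {A : Matrix (Fin 2) (Fin 2) ℤ}
    (hA : IsMinkowskiMatrix (fun _ : Fin 1 => α) m A) {p q p' q' ε : ℤ} (hε : ε * ε = 1)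
    (hq : 0 < q) (hq' : 0 < q') (hlt : (m : ℤ) < q + q') (hdet : p' * q - p * q' = ε)
    (hs : 0 < ε * (q * α - p)) (ht : 0 < ε * (p' - q' * α)) (hqm : q ≤ m) (hqm' : q' ≤ m)
    (hpm : |p| ≤ m) (hpm' : |p'| ≤ m) (hne : p * A 0 0 + q * A 0 1 ≠ 0) :
    A = !![q', -p'; q, -p] ∧ ε * (p' - q' * α) ≤ ε * (q * α - p) := by
  have hε0 : ε ≠ 0 := by rintro rfl; simp at hε
  have hεR : (ε : ℝ) * ε = 1 := by exact_mod_cast hε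
  have hεabs : |(ε : ℝ)| = 1 := by
    rcases mul_self_eq_one_iff.1 hεR with h | h <;> simp [h]
  have hbd : ∀ k, |(![q, -p] : Fin 2 → ℤ) k| ≤ (m : ℤ) := by
    simp [Fin.forall_fin_two, hpm, abs_of_pos hq, hqm]
  have hbd' : ∀ k, |(![q', -p'] : Fin 2 → ℤ) k| ≤ (m : ℤ) := by
    simp [Fin.forall_fin_two, hpm', abs_of_pos hq', hqm']
  obtain ⟨hA0, -, hA0min, hA0pos⟩ := hA 0
  obtain ⟨hA1, hA1ind, hA1min, hA1pos⟩ := hA 1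
  have hmin0 := hA0min ![q, -p] hbd (by
    rw [mem_earlierRowSpan_zero]
    intro h
    simpa [hq.ne'] using congrFun h 0)
  have hmin0' := hA0min ![q', -p'] hbd' (by
    rw [mem_earlierRowSpan_zero]
    intro h
    simpa [hq'.ne'] using congrFun h 0)
  obtain ⟨h00, h01⟩ := eq_of_abs_xi_le hε hq hq' hlt hdet hs ht (hA0 0) hne hA0pos hmin0'
  have hmin1 := hA1min ![q, -p] hbd (notMem_earlierRowSpan_one_of_det (by
    rw [h00, h01]
    simp only [Matrix.cons_val_zero, Matrix.cons_val_one]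
    intro h
    exact hε0 (by linear_combination h - hdet)))
  have hne1 : p' * A 1 0 + q' * A 1 1 ≠ 0 := by
    intro h
    apply hA1ind
    rw [mem_earlierRowSpan_one, h00, h01]
    have hqR : (q' : ℝ) ≠ 0 := by exact_mod_cast hq'.ne'
    have hR : (p' * A 1 0 + q' * A 1 1 : ℝ) = 0 := by exact_mod_cast h
    refine ⟨A 1 0 / q', by field_simp, ?_⟩
    push_cast
    field_simp
    linarith
  obtain ⟨h10, h11⟩ := eq_of_abs_xi_le (ε := -ε) (by linarith) hq' hq (by linarith)
    (by linarith) (by push_cast; linarith) (by push_cast; linarith) (hA1 0) hne1 hA1pos hmin1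
  refine ⟨?_, ?_⟩
  · ext i j
    fin_cases i <;> fin_cases j <;> simp [h00, h01, h10, h11]
  · rw [← abs_of_pos hs, ← abs_of_pos ht, abs_mul, abs_mul, hεabs, abs_sub_comm]
    simpa [xi_one, h00, h01, add_comm, mul_comm, ← sub_eq_add_neg] using hmin0

/-- The two possible shapes of the Minkowski matrix at level `m` in terms of the Farey pair of the
same level. -/
theorem IsMinkowskiMatrix.eq_or_eq {α : ℝ} (hirr : Irrational α) (h0 : 0 < α) (h1 : α < 1)
    {m : ℕ} (hm : 1 ≤ m) {A : Matrix (Fin 2) (Fin 2) ℤ}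
    (hA : IsMinkowskiMatrix (fun _ : Fin 1 => α) m A) {P : ℚ × ℚ}
    (hP : IsSurroundingFareyPair α m P) :
    A = !![(P.2.den : ℤ), -P.2.num; (P.1.den : ℤ), -P.1.num] ∧
        P.2.num - P.2.den * α ≤ P.1.den * α - P.1.num ∨
      A = !![(P.1.den : ℤ), -P.1.num; (P.2.den : ℤ), -P.2.num] ∧
        P.1.den * α - P.1.num ≤ P.2.num - P.2.den * α := by
  obtain ⟨hdet, hlt⟩ := hP.unimodular hirr h0 h1 hm
  obtain ⟨⟨hxy, hx0, hy1, hxm, hym, -⟩, hxα, hαy⟩ := hP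
  have hs := Rat.num_lt_den_mul hxα
  have ht := Rat.den_mul_lt_num hαy
  have hq : (0 : ℤ) < P.1.den := by exact_mod_cast P.1.den_pos
  have hq' : (0 : ℤ) < P.2.den := by exact_mod_cast P.2.den_pos
  have hbound : ∀ z : ℚ, 0 ≤ z → z ≤ 1 → z.den ≤ m → |z.num| ≤ (m : ℤ) := by
    intro z hz0 hz1 hzm
    rw [abs_of_nonneg (Rat.num_nonneg.2 hz0)]
    rw [← Rat.num_div_den z, div_le_one (by exact_mod_cast z.den_pos)] at hz1
    have : z.num ≤ z.den := by exact_mod_cast hz1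
    omega
  have hpm := hbound _ hx0 (hxy.le.trans hy1) hxm
  have hpm' := hbound _ (hx0.trans hxy.le) hy1 hym
  by_cases hne : P.1.num * A 0 0 + P.1.den * A 0 1 = 0
  · right
    have hne' : P.2.num * A 0 0 + P.2.den * A 0 1 ≠ 0 := by
      intro hne'
      apply (hA 0).2.1
      rw [mem_earlierRowSpan_zero]
      have e0 : A 0 0 = 0 := by
        linear_combination (P.1.den : ℤ) * hne' - (P.2.den : ℤ) * hne - A 0 0 * hdet
      have e1 : A 0 1 = 0 := by
        linear_combination P.2.num * hne - P.1.num * hne' - A 0 1 * hdet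
      ext k
      fin_cases k <;> simp [e0, e1]
    have := hA.eq_of_unimodular (ε := -1) (by norm_num) hq' hq (by omega) (by linarith)
      (by push_cast; linarith) (by push_cast; linarith) (by omega) (by omega) hpm' hpm hne'
    refine ⟨this.1, ?_⟩
    have := this.2
    push_cast at this
    linarith
  · left
    have := hA.eq_of_unimodular (ε := 1) (by norm_num) hq hq' (by omega) (by linarith)
      (by push_cast; linarith) (by push_cast; linarith) (by omega) (by omega) hpm hpm' hne
    refine ⟨this.1, ?_⟩
    have := this.2
    push_cast at this
    linarith

/-- The Farey pair at level `m` is read off from the Minkowski matrix of the same level. -/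
theorem IsMinkowskiMatrix.fareyPair_eq {α : ℝ} (hirr : Irrational α) (h0 : 0 < α) (h1 : α < 1)
    {m : ℕ} (hm : 1 ≤ m) {A : Matrix (Fin 2) (Fin 2) ℤ}
    (hA : IsMinkowskiMatrix (fun _ : Fin 1 => α) m A) {P : ℚ × ℚ}
    (hP : IsSurroundingFareyPair α m P) :
    P = (((-A 0 1 : ℤ) : ℚ) / A 0 0, ((-A 1 1 : ℤ) : ℚ) / A 1 0) ∨
      P = (((-A 1 1 : ℤ) : ℚ) / A 1 0, ((-A 0 1 : ℤ) : ℚ) / A 0 0) := by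
  rcases hA.eq_or_eq hirr h0 h1 hm hP with ⟨rfl, -⟩ | ⟨rfl, -⟩ <;>
    simp [Rat.num_div_den]

theorem IsMinkowskiMatrix.eq_iff_fareyPair_eq {α : ℝ} (hirr : Irrational α) (h0 : 0 < α)
    (h1 : α < 1) {m n : ℕ} (hm : 1 ≤ m) (hn : 1 ≤ n) {A A' : Matrix (Fin 2) (Fin 2) ℤ}
    (hA : IsMinkowskiMatrix (fun _ : Fin 1 => α) m A)
    (hA' : IsMinkowskiMatrix (fun _ : Fin 1 => α) n A') {P P' : ℚ × ℚ}
    (hP : IsSurroundingFareyPair α m P) (hP' : IsSurroundingFareyPair α n P') :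
    A = A' ↔ P = P' := by
  constructor
  · rintro rfl
    have hlt : (P.1 : ℝ) < P'.2 := hP.2.1.trans hP'.2.2
    have hlt' : (P'.1 : ℝ) < P.2 := hP'.2.1.trans hP.2.2
    rcases hA.fareyPair_eq hirr h0 h1 hm hP with h | h <;>
    rcases hA'.fareyPair_eq hirr h0 h1 hn hP' with h' | h'
    · rw [h, h']
    · simp [h, h'] at hlt
    · simp [h, h'] at hlt
    · rw [h, h']
  · rintro rfl
    have hne : (P.2.num : ℝ) - P.2.den * α ≠ P.1.den * α - P.1.num := by
      intro h
      refine (hirr.natCast_mul (m := P.1.den + P.2.den) (by have := P.1.den_pos; omega)).ne_int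
        (P.1.num + P.2.num) ?_
      push_cast
      linarith
    rcases hA.eq_or_eq hirr h0 h1 hm hP with ⟨e, h⟩ | ⟨e, h⟩ <;>
    rcases hA'.eq_or_eq hirr h0 h1 hn hP' with ⟨e', h'⟩ | ⟨e', h'⟩
    · rw [e, e']
    · exact absurd (le_antisymm h h') hne
    · exact absurd (le_antisymm h' h) hne
    · rw [e, e']

/-- The positions at which two sequences change agree if the sequences have the same
coincidences. -/
theorem change_indices_eq {X Y : Type*} {f : ℕ → X} {g : ℕ → Y} {s t : ℕ → ℕ}
    (hfg : ∀ m n, 1 ≤ m → 1 ≤ n → (f m = f n ↔ g m = g n))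
    (hs : StrictMono s) (ht : StrictMono t) (hs0 : s 0 = 1) (ht0 : t 0 = 1)
    (hsc : ∀ k m, s k ≤ m → m < s (k + 1) → f m = f (s k))
    (htc : ∀ k m, t k ≤ m → m < t (k + 1) → g m = g (t k))
    (hsne : ∀ k, f (s (k + 1)) ≠ f (s k)) (htne : ∀ k, g (t (k + 1)) ≠ g (t k)) : s = t := by
  have hs1 : ∀ k, 1 ≤ s k := fun k => hs0 ▸ hs.monotone k.zero_le
  have ht1 : ∀ k, 1 ≤ t k := fun k => ht0 ▸ ht.monotone k.zero_le
  funext k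
  induction k with
  | zero => rw [hs0, ht0]
  | succ k ih =>
    apply le_antisymm
    · by_contra! h
      exact htne k ((hfg _ _ (ht1 _) (ht1 _)).1
        (ih ▸ hsc k _ (ih ▸ (ht k.lt_succ_self).le) h))
    · by_contra! h
      exact hsne k ((hfg _ _ (hs1 _) (hs1 _)).2
        (ih ▸ htc k _ (ih ▸ (hs k.lt_succ_self).le) h))

/-- If the `k`-th matrix of the Minkowski chain of an irrational `α ∈ (0,1)` (the case
`n = 1`) is `[[q, -p], [q', -p']]`, then the `k`-th pair of the Hurwitz chain of `α` is
either `(p/q, p'/q')` or `(p'/q', p/q)`. -/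
theorem minkowski_chain_gives_hurwitz_chain
    (α : ℝ) (hirr : Irrational α) (h0 : 0 < α) (h1 : α < 1)
    (B : ℕ → Matrix (Fin 2) (Fin 2) ℤ)
    (hB : IsMinkowskiChain (fun _ : Fin 1 => α) B)
    (H : ℕ → ℚ × ℚ) (hH : IsHurwitzChain α H)
    (k : ℕ) (p q p' q' : ℤ)
    (hmat : B k = !![q, -p; q', -p']) :
    H k = ((p : ℚ) / (q : ℚ), (p' : ℚ) / (q' : ℚ)) ∨
      H k = ((p' : ℚ) / (q' : ℚ), (p : ℚ) / (q : ℚ)) := by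
  obtain ⟨A, s, hA, hs, hs0, hBA, hsc, hsne⟩ := hB
  obtain ⟨f, t, hf, ht, ht0, hHf, htc, htne⟩ := hH
  obtain rfl : s = t := change_indices_eq (fun m n hm hn =>
    (hA m hm).eq_iff_fareyPair_eq hirr h0 h1 hm hn (hA n hn) (hf m hm) (hf n hn))
    hs ht hs0 ht0 hsc htc hsne htne
  have hk : 1 ≤ s k := hs0 ▸ hs.monotone k.zero_le
  rw [hBA] at hmat
  rw [hHf]
  simpa [hmat] using (hA _ hk).fareyPair_eq hirr h0 h1 hk (hf _ hk)
end

section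
/- Suppose α ∈ ℝ is such that {α^n, α^{n-1}, …, α, 1} are linearly independent over ℚ, and let B_1, B_2, … be the Minkowski chain for (α^n, α^{n-1}, …, α). Then α is algebraic of degree ℓ = n+1 over ℚ if and only if the sequence of n-tuples {B_k(α^n, α^{n-1}, …, α)}_{k≥1} takes only finitely many distinct values. -/
/-- The projective (linear fractional) action of an `(n+1)×(n+1)` integer matrix `B` on an
`n`-tuple of reals:
`B(x₁,…,xₙ)ᵢ = (∑ⱼ b_{i,j} xⱼ + b_{i,ℓ}) / (∑ⱼ b_{ℓ,j} xⱼ + b_{ℓ,ℓ})`. -/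
noncomputable def projAct {n : ℕ} (B : Matrix (Fin (n + 1)) (Fin (n + 1)) ℤ)
    (x : Fin n → ℝ) : Fin n → ℝ :=
  fun i =>
    (∑ j : Fin n, (B (Fin.castSucc i) (Fin.castSucc j) : ℝ) * x j +
        (B (Fin.castSucc i) (Fin.last n) : ℝ)) /
      (∑ j : Fin n, (B (Fin.last n) (Fin.castSucc j) : ℝ) * x j +
        (B (Fin.last n) (Fin.last n) : ℝ))

section RowPolynomials

open Polynomial

/-- The polynomial `∑ᵢ rᵢ X^(n-i)`, whose value at `α` is `ξ(r)` for `(αⁿ, …, α)`. -/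
noncomputable def rowPoly {n : ℕ} (r : Fin (n + 1) → ℤ) : ℚ[X] :=
  ∑ i : Fin (n + 1), C (r i : ℚ) * X ^ (n - (i : ℕ))

lemma rowPoly_coeff {n : ℕ} (r : Fin (n + 1) → ℤ) (i : Fin (n + 1)) :
    (rowPoly r).coeff (n - (i : ℕ)) = r i := by
  have h : ∀ j : Fin (n + 1), n - (i : ℕ) = n - (j : ℕ) ↔ i = j := by
    intro j
    have := i.2
    have := j.2
    rw [Fin.ext_iff]
    omega
  simp [rowPoly, coeff_X_pow, h]

lemma rowPoly_natDegree_le {n : ℕ} (r : Fin (n + 1) → ℤ) : (rowPoly r).natDegree ≤ n := by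
  refine natDegree_sum_le_of_forall_le _ _ fun i _ => ?_
  exact (natDegree_C_mul_X_pow_le _ _).trans (Nat.sub_le _ _)

lemma aeval_rowPoly {n : ℕ} {K : Type*} [Field K] [Algebra ℚ K] (x : K) (r : Fin (n + 1) → ℤ) :
    aeval x (rowPoly r) = ∑ i : Fin (n + 1), (r i : K) * x ^ (n - (i : ℕ)) := by
  simp [rowPoly]

lemma xi_powers_eq_sum {n : ℕ} (α : ℝ) (r : Fin (n + 1) → ℤ) :
    xi (fun i : Fin n => α ^ (n - (i : ℕ))) r =
      ∑ i : Fin (n + 1), (r i : ℝ) * α ^ (n - (i : ℕ)) := by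
  simp [xi, Fin.sum_univ_castSucc, mul_comm, add_comm]

lemma xi_powers_eq_aeval {n : ℕ} (α : ℝ) (r : Fin (n + 1) → ℤ) :
    xi (fun i : Fin n => α ^ (n - (i : ℕ))) r = aeval α (rowPoly r) := by
  rw [xi_powers_eq_sum, aeval_rowPoly]

lemma eq_zero_of_aeval_eq_zero {n : ℕ} {α : ℝ}
    (hind : LinearIndependent ℚ (fun i : Fin (n + 1) => α ^ (i : ℕ))) {p : ℚ[X]}
    (hp : p.natDegree ≤ n) (h : aeval α p = 0) : p = 0 := by
  rw [aeval_eq_sum_range' (Nat.lt_succ_of_le hp), Finset.sum_range] at h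
  have := Fintype.linearIndependent_iff.1 hind (fun i => p.coeff i) h
  ext k
  rcases lt_or_ge k (n + 1) with hk | hk
  · exact this ⟨k, hk⟩
  · exact coeff_eq_zero_of_natDegree_lt (by omega)

lemma xi_powers_ne_zero {n : ℕ} {α : ℝ}
    (hind : LinearIndependent ℚ (fun i : Fin (n + 1) => α ^ (i : ℕ))) {r : Fin (n + 1) → ℤ}
    (hr : r ≠ 0) : xi (fun i : Fin n => α ^ (n - (i : ℕ))) r ≠ 0 := by
  intro h
  rw [xi_powers_eq_aeval] at h
  have h0 := eq_zero_of_aeval_eq_zero hind (rowPoly_natDegree_le r) h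
  apply hr
  ext i
  have := rowPoly_coeff r i
  rw [h0, coeff_zero] at this
  exact_mod_cast this.symm

lemma projAct_apply_eq_div {n : ℕ} (B : Matrix (Fin (n + 1)) (Fin (n + 1)) ℤ)
    (x : Fin n → ℝ) (i : Fin n) :
    projAct B x i = xi x (B i.castSucc) / xi x (B (Fin.last n)) := by
  simp [projAct, xi, mul_comm, add_comm]

/-- If an integer matrix has `(αⁿ, …, α, 1)` as an eigenvector, then it is scalar or `α` is
algebraic of degree `n + 1`. -/
lemma scalar_or_algebraic_of_eigenvector {n : ℕ} {α : ℝ}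
    (hind : LinearIndependent ℚ (fun i : Fin (n + 1) => α ^ (i : ℕ)))
    (R : Matrix (Fin (n + 1)) (Fin (n + 1)) ℤ) (μ : ℝ)
    (hR : ∀ i, xi (fun i : Fin n => α ^ (n - (i : ℕ))) (R i) = μ * α ^ (n - (i : ℕ))) :
    (∃ c : ℤ, R = Matrix.scalar _ c) ∨
      (IsAlgebraic ℚ α ∧ (minpoly ℚ α).natDegree = n + 1) := by
  set P := rowPoly (R (Fin.last n)) with hP
  have hPn : P.natDegree ≤ n := rowPoly_natDegree_le _
  have hμ : aeval α P = μ := by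
    rw [hP, ← xi_powers_eq_aeval, hR]
    simp
  have hroot : ∀ i : Fin (n + 1), aeval α (P * X ^ (n - (i : ℕ)) - rowPoly (R i)) = 0 := by
    intro i
    rw [map_sub, map_mul, hμ, ← xi_powers_eq_aeval, hR]
    simp
  by_cases hd : P.natDegree = 0
  · left
    refine ⟨R (Fin.last n) (Fin.last n), ?_⟩
    have hc : P = C ((R (Fin.last n) (Fin.last n) : ℤ) : ℚ) := by
      rw [eq_C_of_natDegree_eq_zero hd]
      congr 1
      have := rowPoly_coeff (R (Fin.last n)) (Fin.last n)
      simpa using this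
    ext i j
    have h0 : P * X ^ (n - (i : ℕ)) - rowPoly (R i) = 0 := by
      refine eq_zero_of_aeval_eq_zero hind ?_ (hroot i)
      refine (natDegree_sub_le _ _).trans (max_le ?_ (rowPoly_natDegree_le _))
      rw [hc]
      exact (natDegree_C_mul_X_pow_le _ _).trans (Nat.sub_le _ _)
    have h1 := congrArg (fun p => coeff p (n - (j : ℕ))) h0
    simp only [coeff_sub, rowPoly_coeff, hc, coeff_C_mul, coeff_X_pow, coeff_zero] at h1
    have h : n - (j : ℕ) = n - (i : ℕ) ↔ i = j := by
      have := i.2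
      have := j.2
      rw [Fin.ext_iff]
      omega
    simp only [h] at h1
    by_cases hij : i = j
    · subst hij
      simp only [if_true, mul_one] at h1
      simp only [Matrix.scalar_apply, Matrix.diagonal_apply_eq]
      exact_mod_cast (sub_eq_zero.1 h1).symm
    · simp only [hij, if_false, mul_zero, zero_sub, neg_eq_zero] at h1
      simp only [Matrix.scalar_apply, Matrix.diagonal_apply_ne _ hij]
      exact_mod_cast h1
  · right
    have hi : P.natDegree - 1 < n + 1 := by omega
    set Q := P * X ^ (n - (P.natDegree - 1)) - rowPoly (R ⟨_, hi⟩) with hQ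
    have hP0 : P ≠ 0 := by
      rintro h
      simp [h] at hd
    have hdeg1 : (P * X ^ (n - (P.natDegree - 1))).natDegree = n + 1 := by
      rw [natDegree_mul_X_pow _ hP0]
      omega
    have hdeg : Q.natDegree = n + 1 := by
      rw [hQ, natDegree_sub_eq_left_of_natDegree_lt, hdeg1]
      rw [hdeg1]
      exact Nat.lt_succ_of_le (rowPoly_natDegree_le _)
    have hQ0 : Q ≠ 0 := by
      rintro h
      simp [h] at hdeg
    have hQr : aeval α Q = 0 := hroot ⟨_, hi⟩
    have halg : IsAlgebraic ℚ α := ⟨Q, hQ0, hQr⟩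
    refine ⟨halg, le_antisymm ?_ ?_⟩
    · rw [← hdeg]
      exact natDegree_le_of_dvd (minpoly.dvd ℚ α hQr) hQ0
    · by_contra! hlt
      exact minpoly.ne_zero halg.isIntegral
        (eq_zero_of_aeval_eq_zero hind (by omega) (minpoly.aeval ℚ α))

end RowPolynomials

section Rows

lemma det_ne_zero_of_notMem_earlierRowSpan {n : ℕ} {A : Matrix (Fin (n + 1)) (Fin (n + 1)) ℤ}
    (hA : ∀ j, (fun k => (A j k : ℝ)) ∉ earlierRowSpan A j) : A.det ≠ 0 := by
  intro hdet
  obtain ⟨c, hc0, hc⟩ := Matrix.exists_vecMul_eq_zero_iff.2 hdet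
  obtain ⟨j, hj, hmax⟩ : ∃ j, c j ≠ 0 ∧ ∀ i, j < i → c i = 0 := by
    obtain ⟨i₀, hi₀⟩ := Function.ne_iff.1 hc0
    obtain ⟨j, hj⟩ := (Finset.univ.filter fun i => c i ≠ 0).exists_maximal
      ⟨i₀, by simpa using hi₀⟩
    refine ⟨j, by simpa using hj.1, fun i hi => ?_⟩
    by_contra h
    exact absurd (hj.2 (by simpa using h) hi.le) (not_le.2 hi)
  apply hA j
  have hcj : (c j : ℝ) ≠ 0 := by exact_mod_cast hj
  have key : (fun k => (A j k : ℝ)) =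
      ∑ i ∈ Finset.univ.filter (· < j), (-(c i : ℝ) / c j) • (fun k => (A i k : ℝ)) := by
    ext k
    have h1 : ∑ i, (c i : ℝ) * A i k = 0 := by
      have := congrFun hc k
      simp only [Matrix.vecMul, dotProduct, Pi.zero_apply] at this
      exact_mod_cast this
    have h2 : ∑ i, (c i : ℝ) * A i k =
        ∑ i ∈ Finset.univ.filter (· < j), (c i : ℝ) * A i k + c j * A j k := by
      rw [← Finset.sum_filter_add_sum_filter_not _ (· < j)]
      congr 1
      refine Finset.sum_eq_single j ?_ (by simp)
      intro i hi hij
      rw [Finset.mem_filter] at hi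
      rw [hmax i (lt_of_le_of_ne (not_lt.1 hi.2) (Ne.symm hij))]
      simp
    rw [h1] at h2
    simp only [Finset.sum_apply, Pi.smul_apply, smul_eq_mul]
    have h3 : ∑ i ∈ Finset.univ.filter (· < j), -(c i : ℝ) / c j * A i k =
        -(∑ i ∈ Finset.univ.filter (· < j), (c i : ℝ) * A i k) / c j := by
      rw [neg_div, Finset.sum_div, ← Finset.sum_neg_distrib]
      exact Finset.sum_congr rfl fun i _ => by ring
    rw [h3, eq_div_iff hcj]
    linarith
  rw [key]
  refine Submodule.sum_mem _ fun i hi => Submodule.smul_mem _ _ (Submodule.subset_span ?_)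
  exact ⟨i, (Finset.mem_filter.1 hi).2, rfl⟩

lemma exists_row_notMem_earlierRowSpan {n : ℕ} (A : Matrix (Fin (n + 1)) (Fin (n + 1)) ℤ)
    (j : Fin (n + 1)) {U : Matrix (Fin (n + 1)) (Fin (n + 1)) ℤ} (hU : U.det ≠ 0) :
    ∃ i, (fun k => (U i k : ℝ)) ∉ earlierRowSpan A j := by
  by_contra! h
  have hli : LinearIndependent ℝ (fun i k => (U i k : ℝ)) := by
    have : IsUnit (U.map (Int.castRingHom ℝ)) := by
      rw [Matrix.isUnit_iff_isUnit_det, ← RingHom.mapMatrix_apply, ← RingHom.map_det]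
      simpa using hU
    exact Matrix.linearIndependent_rows_iff_isUnit.2 this
  have hli' : LinearIndependent ℝ
      (fun i => (⟨fun k => (U i k : ℝ), h i⟩ : earlierRowSpan A j)) :=
    LinearIndependent.of_comp (earlierRowSpan A j).subtype hli
  have h1 := hli'.fintype_card_le_finrank
  have hspan : earlierRowSpan A j = Submodule.span ℝ
      (((Finset.Iio j).image fun i k => (A i k : ℝ) : Finset (Fin (n + 1) → ℝ)) :
        Set (Fin (n + 1) → ℝ)) := by
    unfold earlierRowSpan
    congr 1
    ext x
    simp [eq_comm]
  have h2 : Module.finrank ℝ (earlierRowSpan A j) ≤ j := by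
    rw [hspan]
    refine (finrank_span_finset_le_card _).trans (Finset.card_image_le.trans ?_)
    simp
  rw [Fintype.card_fin] at h1
  have := j.2
  omega

/-- Independent integer vectors of norm at most `m` bound every `β_j(m)`. -/
lemma IsMinkowskiMatrix.abs_xi_le {n : ℕ} {x : Fin n → ℝ} {m : ℕ}
    {A : Matrix (Fin (n + 1)) (Fin (n + 1)) ℤ} (hA : IsMinkowskiMatrix x m A)
    {U : Matrix (Fin (n + 1)) (Fin (n + 1)) ℤ} (hU : U.det ≠ 0)
    (hm : ∀ i k, |U i k| ≤ (m : ℤ)) {Y : ℝ} (hY : ∀ i, |xi x (U i)| ≤ Y) (j : Fin (n + 1)) :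
    |xi x (A j)| ≤ Y := by
  obtain ⟨i, hi⟩ := exists_row_notMem_earlierRowSpan A j hU
  exact ((hA j).2.2.1 (U i) (hm i) hi).trans (hY i)

lemma IsMinkowskiMatrix.row_ne_zero {n : ℕ} {x : Fin n → ℝ} {m : ℕ}
    {A : Matrix (Fin (n + 1)) (Fin (n + 1)) ℤ} (hA : IsMinkowskiMatrix x m A)
    (j : Fin (n + 1)) : A j ≠ 0 := by
  obtain ⟨k, hk, -⟩ := (hA j).2.2.2
  intro h
  simp [h] at hk

lemma notMem_earlierRowSpan_zero {n : ℕ} (A : Matrix (Fin (n + 1)) (Fin (n + 1)) ℤ)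
    {w : Fin (n + 1) → ℤ} (hw : w ≠ 0) : (fun k => (w k : ℝ)) ∉ earlierRowSpan A 0 := by
  have : earlierRowSpan A 0 = ⊥ := by simp [earlierRowSpan]
  rw [this, Submodule.mem_bot]
  intro h
  apply hw
  ext k
  simpa using congrFun h k

/-- Dirichlet's approximation theorem for a linear form in `n + 1` variables. -/
lemma exists_small_linear_form {n : ℕ} (v : Fin (n + 1) → ℝ) :
    ∃ C : ℝ, 0 < C ∧ ∀ m : ℕ, 1 ≤ m → ∃ w : Fin (n + 1) → ℤ, w ≠ 0 ∧
      (∀ k, |w k| ≤ (m : ℤ)) ∧ |∑ k, (w k : ℝ) * v k| ≤ C / (m : ℝ) ^ n := by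
  set S : ℝ := 1 + ∑ k, |v k| with hS
  have hS0 : 0 < S := by positivity
  refine ⟨2 * S, by positivity, fun m hm => ?_⟩
  have hm0 : (0 : ℝ) < m := by exact_mod_cast hm
  set L : (Fin (n + 1) → ℤ) → ℝ := fun w => ∑ k, (w k : ℝ) * v k with hL
  set s : Finset (Fin (n + 1) → ℤ) := Fintype.piFinset fun _ => Finset.Icc (0 : ℤ) m with hs
  set t : Finset ℤ := Finset.Ico (0 : ℤ) ((m : ℤ) ^ (n + 1)) with ht
  have hcard : t.card < s.card := by
    simp only [ht, hs, Int.card_Ico, Fintype.card_piFinset, Int.card_Icc, Finset.prod_const,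
      Finset.card_univ, Fintype.card_fin, sub_zero]
    have h1 : ((m : ℤ) ^ (n + 1)).toNat = m ^ (n + 1) := by
      rw [← Nat.cast_pow, Int.toNat_natCast]
    have h2 : ((m : ℤ) + 1).toNat = m + 1 := by omega
    rw [h1, h2]
    exact Nat.pow_lt_pow_left (Nat.lt_succ_self m) (by omega)
  have hbound : ∀ w ∈ s, |L w| < m * S := by
    intro w hw
    rw [hs, Fintype.mem_piFinset] at hw
    have : |L w| ≤ m * ∑ k, |v k| := by
      rw [Finset.mul_sum]
      refine (Finset.abs_sum_le_sum_abs _ _).trans (Finset.sum_le_sum fun k _ => ?_)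
      rw [abs_mul]
      have hk := Finset.mem_Icc.1 (hw k)
      refine mul_le_mul_of_nonneg_right ?_ (abs_nonneg _)
      rw [abs_of_nonneg (by exact_mod_cast hk.1)]
      exact_mod_cast hk.2
    nlinarith
  set f : (Fin (n + 1) → ℤ) → ℤ := fun w => ⌊(L w + m * S) * ((m : ℝ) ^ n / (2 * S))⌋ with hf
  have hmaps : Set.MapsTo f s t := by
    intro w hw
    have hb := abs_lt.1 (hbound w hw)
    simp only [ht, Finset.coe_Ico, Set.mem_Ico, hf]
    refine ⟨Int.floor_nonneg.2 (mul_nonneg (by linarith) (by positivity)), Int.floor_lt.2 ?_⟩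
    have : (L w + m * S) * ((m : ℝ) ^ n / (2 * S)) < (2 * (m * S)) * ((m : ℝ) ^ n / (2 * S)) :=
      mul_lt_mul_of_pos_right (by linarith) (by positivity)
    refine this.trans_eq ?_
    push_cast
    field_simp
    ring
  obtain ⟨a, ha, b, hb, hab, hfab⟩ := Finset.exists_ne_map_eq_of_card_lt_of_maps_to hcard hmaps
  refine ⟨a - b, sub_ne_zero.2 hab, fun k => ?_, ?_⟩
  · rw [hs, Fintype.mem_piFinset] at ha hb
    have h1 := Finset.mem_Icc.1 (ha k)
    have h2 := Finset.mem_Icc.1 (hb k)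
    rw [Pi.sub_apply, abs_le]
    omega
  · have h1 := (Int.abs_sub_lt_one_of_floor_eq_floor hfab).le
    rw [← sub_mul, add_sub_add_right_eq_sub, abs_mul,
      abs_of_pos (show (0 : ℝ) < (m : ℝ) ^ n / (2 * S) by positivity)] at h1
    have h2 : ∑ k, ((a - b) k : ℝ) * v k = L a - L b := by
      simp [hL, sub_mul]
    rw [h2, le_div_iff₀ (by positivity)]
    rw [← mul_div_assoc, div_le_one (by positivity)] at h1
    exact h1

end Rows

section UpperBound

open Polynomial

lemma exists_integer_coordinates {n : ℕ} {α : ℝ} (halg : IsAlgebraic ℚ α)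
    (hdeg : (minpoly ℚ α).natDegree = n + 1) (e : ℕ) :
    ∃ D : ℤ, D ≠ 0 ∧ ∃ c : Fin (n + 1) → ℤ,
      D * α ^ e = ∑ j : Fin (n + 1), (c j : ℝ) * α ^ (n - (j : ℕ)) := by
  set q := (X ^ e : ℚ[X]) %ₘ minpoly ℚ α with hq
  have hqd : q.natDegree < n + 1 := by
    rw [← hdeg]
    refine natDegree_modByMonic_lt _ (minpoly.monic halg.isIntegral) ?_
    intro h
    simp [h] at hdeg
  have hqe : aeval α q = α ^ e := by
    rw [hq, minpoly.aeval_modByMonic_minpoly]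
    simp
  obtain ⟨b, hb⟩ := IsLocalization.exist_integer_multiples_of_finite (nonZeroDivisors ℤ)
    (fun i : Fin (n + 1) => q.coeff (n - (i : ℕ)))
  choose c hc using hb
  refine ⟨b, nonZeroDivisors.coe_ne_zero b, c, ?_⟩
  rw [← hqe, aeval_eq_sum_range' hqd, Finset.sum_range, ← Equiv.sum_comp Fin.revPerm,
    Finset.mul_sum]
  refine Finset.sum_congr rfl fun i _ => ?_
  have h1 : ((c i : ℤ) : ℚ) = (b : ℤ) * q.coeff (n - (i : ℕ)) := by
    have := hc i
    simpa using this
  have h2 : (c i : ℝ) = (b : ℤ) * (q.coeff (n - (i : ℕ)) : ℝ) := by exact_mod_cast h1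
  rw [h2, Fin.revPerm_apply, Fin.val_rev, Nat.add_sub_add_right, Rat.smul_def]
  ring

lemma exists_integer_coordinates_lt {n : ℕ} {α : ℝ} (halg : IsAlgebraic ℚ α)
    (hdeg : (minpoly ℚ α).natDegree = n + 1) (N : ℕ) :
    ∃ D : ℤ, D ≠ 0 ∧ ∀ e < N, ∃ c : Fin (n + 1) → ℤ,
      D * α ^ e = ∑ j : Fin (n + 1), (c j : ℝ) * α ^ (n - (j : ℕ)) := by
  induction N with
  | zero => exact ⟨1, one_ne_zero, by simp⟩
  | succ N ih =>
    obtain ⟨D, hD, h⟩ := ih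
    obtain ⟨D', hD', c', hc'⟩ := exists_integer_coordinates halg hdeg N
    refine ⟨D * D', mul_ne_zero hD hD', fun e he => ?_⟩
    rcases Nat.lt_succ_iff_lt_or_eq.1 he with he | rfl
    · obtain ⟨c, hc⟩ := h e he
      refine ⟨fun j => D' * c j, ?_⟩
      push_cast
      rw [mul_comm (D : ℝ), mul_assoc, hc, Finset.mul_sum]
      exact Finset.sum_congr rfl fun i _ => by ring
    · refine ⟨fun j => D * c' j, ?_⟩
      push_cast
      rw [mul_assoc, hc', Finset.mul_sum]
      exact Finset.sum_congr rfl fun i _ => by ring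

lemma det_ne_zero_of_xi_eq {n : ℕ} {α t : ℝ}
    (hind : LinearIndependent ℚ (fun i : Fin (n + 1) => α ^ (i : ℕ))) (ht : t ≠ 0)
    {U : Matrix (Fin (n + 1)) (Fin (n + 1)) ℤ}
    (hU : ∀ i, xi (fun i : Fin n => α ^ (n - (i : ℕ))) (U i) = t * α ^ (i : ℕ)) :
    U.det ≠ 0 := by
  intro hdet
  obtain ⟨c, hc0, hc⟩ := Matrix.exists_vecMul_eq_zero_iff.2 hdet
  have h1 : ∑ i, (c i : ℝ) * xi (fun i : Fin n => α ^ (n - (i : ℕ))) (U i) = 0 := by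
    simp only [xi_powers_eq_sum, Finset.mul_sum]
    rw [Finset.sum_comm]
    refine Finset.sum_eq_zero fun k _ => ?_
    have h2 : ∑ i, (c i : ℝ) * U i k = 0 := by
      have := congrFun hc k
      simp only [Matrix.vecMul, dotProduct, Pi.zero_apply] at this
      exact_mod_cast this
    simp only [← mul_assoc]
    rw [← Finset.sum_mul, h2, zero_mul]
  have h3 : t * ∑ i, (c i : ℝ) * α ^ (i : ℕ) = 0 := by
    rw [← h1, Finset.mul_sum]
    exact Finset.sum_congr rfl fun i _ => by rw [hU]; ring
  have h4 := (mul_eq_zero.1 h3).resolve_left ht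
  have h5 := Fintype.linearIndependent_iff.1 hind (fun i => (c i : ℚ))
    (by simpa [Rat.smul_def] using h4)
  exact hc0 (funext fun i => by exact_mod_cast h5 i)

/-- For `α` algebraic of degree `n + 1`, every `β_j(m)` is `O(m⁻ⁿ)`. -/
lemma exists_abs_xi_le_of_algebraic {n : ℕ} {α : ℝ}
    (hind : LinearIndependent ℚ (fun i : Fin (n + 1) => α ^ (i : ℕ)))
    (halg : IsAlgebraic ℚ α) (hdeg : (minpoly ℚ α).natDegree = n + 1) :
    ∃ C : ℝ, 0 < C ∧ ∀ m : ℕ, 1 ≤ m → ∀ A : Matrix (Fin (n + 1)) (Fin (n + 1)) ℤ,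
      IsMinkowskiMatrix (fun i : Fin n => α ^ (n - (i : ℕ))) m A →
      ∀ j, |xi (fun i : Fin n => α ^ (n - (i : ℕ))) (A j)| ≤ C / (m : ℝ) ^ n := by
  obtain ⟨D, hD, hDc⟩ := exists_integer_coordinates_lt halg hdeg (2 * n + 1)
  have hDc' : ∀ i k : Fin (n + 1), ∃ c : Fin (n + 1) → ℤ,
      D * α ^ ((i : ℕ) + (n - (k : ℕ))) =
        ∑ j : Fin (n + 1), (c j : ℝ) * α ^ (n - (j : ℕ)) :=
    fun i k => hDc _ (by have := i.2; omega)
  choose c hc using hDc'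
  obtain ⟨C₀, hC₀, hdir⟩ := exists_small_linear_form
    (fun k : Fin (n + 1) => α ^ (n - (k : ℕ)))
  set E : ℕ := 1 + ∑ i, ∑ j, ∑ k, (c i k j).natAbs with hE
  have hE1 : 1 ≤ E := Nat.le_add_right _ _
  have hE0 : (0 : ℝ) < E := by exact_mod_cast hE1
  set G : ℝ := 1 + ∑ i : Fin (n + 1), |α ^ (i : ℕ)| with hG
  set V : ℝ := 1 + ∑ i : Fin (n + 1), |α ^ (n - (i : ℕ))| with hV
  have hD0 : (0 : ℝ) < |(D : ℝ)| := abs_pos.2 (by exact_mod_cast hD)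
  have hG0 : 0 < G := by positivity
  have hV0 : 0 < V := by positivity
  refine ⟨V * E ^ n + |(D : ℝ)| * G * C₀ * (2 * E) ^ n, by positivity, fun m hm A hA => ?_⟩
  have hm0 : (0 : ℝ) < m := by exact_mod_cast hm
  rcases lt_or_ge m E with hmE | hmE
  · refine hA.abs_xi_le (U := 1) (by simp) ?_ ?_
    · intro i k
      rw [Matrix.one_apply]
      split_ifs
      · simpa using hm
      · simp
    · intro i
      have h1 : xi (fun i : Fin n => α ^ (n - (i : ℕ)))
          ((1 : Matrix (Fin (n + 1)) (Fin (n + 1)) ℤ) i) = α ^ (n - (i : ℕ)) := by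
        rw [xi_powers_eq_sum]
        simp [Matrix.one_apply]
      rw [h1, le_div_iff₀ (by positivity)]
      have h2 : |α ^ (n - (i : ℕ))| ≤ V := by
        have := Finset.single_le_sum (f := fun i : Fin (n + 1) => |α ^ (n - (i : ℕ))|)
          (fun _ _ => abs_nonneg _) (Finset.mem_univ i)
        linarith
      have h3 : (m : ℝ) ^ n ≤ (E : ℝ) ^ n :=
        pow_le_pow_left₀ hm0.le (by exact_mod_cast hmE.le) n
      have h4 : |α ^ (n - (i : ℕ))| * (m : ℝ) ^ n ≤ V * E ^ n := by gcongr
      have : 0 ≤ |(D : ℝ)| * G * C₀ * (2 * E) ^ n := by positivity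
      linarith
  · set m' := m / E
    have hm'1 : 1 ≤ m' := (Nat.one_le_div_iff hE1).2 hmE
    have hm'0 : (0 : ℝ) < m' := by exact_mod_cast hm'1
    have hEm : E * m' ≤ m := Nat.mul_div_le m E
    have hmm : (m : ℝ) ≤ 2 * E * m' := by
      have h1 : m < E * (m' + 1) := by
        exact Nat.lt_mul_div_succ m hE1
      have h2 : E * (m' + 1) ≤ 2 * E * m' := by nlinarith
      exact_mod_cast (h1.le.trans h2)
    obtain ⟨w, hw0, hwm, hwC⟩ := hdir m' hm'1
    rw [← xi_powers_eq_sum] at hwC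
    set β := xi (fun i : Fin n => α ^ (n - (i : ℕ))) w with hβ
    have hβ0 : β ≠ 0 := xi_powers_ne_zero hind hw0
    set U : Matrix (Fin (n + 1)) (Fin (n + 1)) ℤ :=
      Matrix.of fun i j => ∑ k, w k * c i k j with hU
    have hxi : ∀ i, xi (fun i : Fin n => α ^ (n - (i : ℕ))) (U i) =
        (D * β) * α ^ (i : ℕ) := by
      intro i
      rw [xi_powers_eq_sum, hβ, xi_powers_eq_sum, mul_assoc, Finset.sum_mul, Finset.mul_sum]
      simp only [hU, Matrix.of_apply, Int.cast_sum, Int.cast_mul, Finset.sum_mul]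
      rw [Finset.sum_comm]
      refine Finset.sum_congr rfl fun k _ => ?_
      have h1 : (D : ℝ) * ((w k : ℝ) * α ^ (n - (k : ℕ)) * α ^ (i : ℕ)) =
          w k * (D * α ^ ((i : ℕ) + (n - (k : ℕ)))) := by
        rw [pow_add]
        ring
      rw [h1, hc, Finset.mul_sum]
      exact Finset.sum_congr rfl fun j _ => by ring
    refine hA.abs_xi_le (U := U)
      (det_ne_zero_of_xi_eq hind (mul_ne_zero (by exact_mod_cast hD) hβ0) hxi) ?_ ?_
    · intro i j
      have h1 : |U i j| ≤ m' * ∑ k, |c i k j| := by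
        change |∑ k, w k * c i k j| ≤ _
        rw [Finset.mul_sum]
        refine (Finset.abs_sum_le_sum_abs _ _).trans (Finset.sum_le_sum fun k _ => ?_)
        rw [abs_mul]
        exact mul_le_mul_of_nonneg_right (hwm k) (abs_nonneg _)
      have h2 : ∑ k, (c i k j).natAbs ≤ E := by
        have h3 := Finset.single_le_sum (f := fun j => ∑ k, (c i k j).natAbs)
          (fun _ _ => Nat.zero_le _) (Finset.mem_univ j)
        have h4 := Finset.single_le_sum (f := fun i => ∑ j, ∑ k, (c i k j).natAbs)
          (fun _ _ => Nat.zero_le _) (Finset.mem_univ i)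
        omega
      have h5 : ∑ k, |c i k j| ≤ (E : ℤ) := by
        simp only [Int.abs_eq_natAbs]
        exact_mod_cast h2
      calc |U i j| ≤ m' * ∑ k, |c i k j| := h1
        _ ≤ m' * E := by gcongr
        _ ≤ m := by rw [mul_comm]; exact_mod_cast hEm
    · intro i
      rw [hxi, abs_mul, abs_mul]
      have h1 : |α ^ (i : ℕ)| ≤ G := by
        have := Finset.single_le_sum (f := fun i : Fin (n + 1) => |α ^ (i : ℕ)|)
          (fun _ _ => abs_nonneg _) (Finset.mem_univ i)
        linarith
      have h2 : C₀ / (m' : ℝ) ^ n ≤ C₀ * (2 * E) ^ n / (m : ℝ) ^ n := by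
        rw [div_le_div_iff₀ (by positivity) (by positivity), mul_assoc, ← mul_pow]
        gcongr
      calc |(D : ℝ)| * |β| * |α ^ (i : ℕ)|
          ≤ |(D : ℝ)| * (C₀ * (2 * E) ^ n / (m : ℝ) ^ n) * G := by
            gcongr
            exact hwC.trans h2
        _ = (|(D : ℝ)| * G * C₀ * (2 * E) ^ n) / (m : ℝ) ^ n := by ring
        _ ≤ _ := by
            gcongr
            have : 0 ≤ V * (E : ℝ) ^ n := by positivity
            linarith

end UpperBound

section Ratios

open NumberField

/-- A nonzero algebraic integer divides the absolute value of its norm. -/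
lemma exists_nat_eq_mul_of_prod_norm_le {K : Type*} [Field K] [NumberField K] {x : K}
    (hx0 : x ≠ 0) (hx : IsIntegral ℤ x) :
    ∃ (N : ℕ) (q : K), 1 ≤ N ∧ (N : ℝ) = ∏ σ : K →ₐ[ℚ] ℂ, ‖σ x‖ ∧ IsIntegral ℤ q ∧
      (N : K) = x * q := by
  set X : 𝓞 K := ⟨x, hx⟩
  have hmem := Ideal.absNorm_mem (Ideal.span {X})
  rw [Ideal.mem_span_singleton] at hmem
  obtain ⟨q, hq⟩ := hmem
  rw [Ideal.absNorm_span_singleton] at hq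
  have hX0 : X ≠ 0 := fun h => hx0 (congrArg (algebraMap (𝓞 K) K) h)
  refine ⟨(Algebra.norm ℤ X).natAbs, q, ?_, ?_, q.2, ?_⟩
  · exact Nat.one_le_iff_ne_zero.2 (Int.natAbs_ne_zero.2 (Algebra.norm_ne_zero_iff.2 hX0))
  · have h1 := Algebra.norm_eq_prod_embeddings ℚ ℂ x
    have h2 : ((Algebra.norm ℤ X : ℤ) : ℚ) = Algebra.norm ℚ x := Algebra.coe_norm_int X
    rw [← norm_prod, ← h1, ← h2]
    simp [Nat.cast_natAbs]
  · have := congrArg (algebraMap (𝓞 K) K) hq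
    rwa [map_natCast, map_mul] at this

/-- Algebraic integers of comparable sizes at all places, small at the place `τ`, have only
finitely many quotients. -/
lemma finite_quotients_of_norm_le {K : Type*} [Field K] [NumberField K] (τ : K →ₐ[ℚ] ℂ) {n : ℕ}
    (hn : Module.finrank ℚ K = n + 1) (C : ℝ) (hC : 0 < C) :
    {z : K | ∃ (m : ℝ) (x y : K), 0 < m ∧ x ≠ 0 ∧ IsIntegral ℤ x ∧ IsIntegral ℤ y ∧
      (‖τ x‖ ≤ C / m ^ n ∧ ∀ σ : K →ₐ[ℚ] ℂ, ‖σ x‖ ≤ C * m) ∧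
      (‖τ y‖ ≤ C / m ^ n ∧ ∀ σ : K →ₐ[ℚ] ℂ, ‖σ y‖ ≤ C * m) ∧ z = y / x}.Finite := by
  classical
  set P : ℕ := (⌊C ^ (n + 1)⌋₊).factorial with hP
  have hP0 : (P : K) ≠ 0 := by exact_mod_cast (Nat.factorial_pos _).ne'
  refine ((Embeddings.finite_of_norm_le K ℂ (P * C ^ (n + 1))).image
    (fun u => u / (P : K))).subset ?_
  rintro _ ⟨m, x, y, hm, hx0, hx, hy, ⟨hxτ, hxσ⟩, ⟨hyτ, hyσ⟩, rfl⟩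
  set g : (K →ₐ[ℚ] ℂ) → ℝ := fun σ => if σ = τ then C / m ^ n else C * m with hg
  have hg0 : ∀ σ, 0 ≤ g σ := by
    intro σ
    simp only [hg]
    split_ifs <;> positivity
  have hprod : ∏ σ, g σ = C ^ (n + 1) := by
    rw [← Finset.mul_prod_erase _ _ (Finset.mem_univ τ)]
    have h1 : ∏ σ ∈ Finset.univ.erase τ, g σ = (C * m) ^ n := by
      rw [Finset.prod_congr rfl (g := fun _ => C * m), Finset.prod_const,
        Finset.card_erase_of_mem (Finset.mem_univ _), Finset.card_univ, AlgHom.card, hn,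
        Nat.add_sub_cancel]
      intro σ hσ
      simp [hg, (Finset.mem_erase.1 hσ).1]
    rw [h1]
    simp only [hg, if_true]
    field_simp
    ring
  have hxg : ∀ σ, ‖σ x‖ ≤ g σ := by
    intro σ
    simp only [hg]
    split_ifs with h
    · rw [h]; exact hxτ
    · exact hxσ σ
  have hyg : ∀ σ, ‖σ y‖ ≤ g σ := by
    intro σ
    simp only [hg]
    split_ifs with h
    · rw [h]; exact hyτ
    · exact hyσ σ
  obtain ⟨N, q, hN1, hN, hq, hNq⟩ := exists_nat_eq_mul_of_prod_norm_le hx0 hx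
  have hNC : N ≤ ⌊C ^ (n + 1)⌋₊ := by
    refine Nat.le_floor ?_
    rw [hN, ← hprod]
    exact Finset.prod_le_prod (fun _ _ => norm_nonneg _) fun σ _ => hxg σ
  obtain ⟨t, ht⟩ := Nat.dvd_factorial hN1 hNC
  refine ⟨P * (y / x), ⟨?_, fun φ => ?_⟩, by field_simp⟩
  · have : (P : K) * (y / x) = t * q * y := by
      rw [hP, ht, Nat.cast_mul, hNq]
      field_simp
    rw [this]
    exact (((map_natCast (algebraMap ℤ K) t) ▸ isIntegral_algebraMap).mul hq).mul hy
  · set σ : K →ₐ[ℚ] ℂ := φ.toRatAlgHom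
    have hφ : ∀ a, φ a = σ a := fun _ => rfl
    rw [map_mul, map_div₀, norm_mul, norm_div, map_natCast, Complex.norm_natCast, hφ, hφ]
    refine mul_le_mul_of_nonneg_left ?_ (Nat.cast_nonneg _)
    have hσx : 0 < ‖σ x‖ := norm_pos_iff.2 ((map_ne_zero σ).2 hx0)
    have h1 : ‖σ y‖ * ∏ σ' ∈ Finset.univ.erase σ, ‖σ' x‖ ≤ C ^ (n + 1) := by
      rw [← hprod, ← Finset.mul_prod_erase _ _ (Finset.mem_univ σ)]
      exact mul_le_mul (hyg σ)
        (Finset.prod_le_prod (fun _ _ => norm_nonneg _) fun σ' _ => hxg σ')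
        (Finset.prod_nonneg fun _ _ => norm_nonneg _) (hg0 σ)
    have h2 : 1 ≤ ‖σ x‖ * ∏ σ' ∈ Finset.univ.erase σ, ‖σ' x‖ := by
      rw [Finset.mul_prod_erase _ (fun σ' : K →ₐ[ℚ] ℂ => ‖σ' x‖) (Finset.mem_univ σ), ← hN]
      exact_mod_cast hN1
    rw [div_le_iff₀ hσx]
    calc ‖σ y‖ = ‖σ y‖ * 1 := (mul_one _).symm
      _ ≤ ‖σ y‖ * (‖σ x‖ * ∏ σ' ∈ Finset.univ.erase σ, ‖σ' x‖) := by gcongr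
      _ = (‖σ y‖ * ∏ σ' ∈ Finset.univ.erase σ, ‖σ' x‖) * ‖σ x‖ := by ring
      _ ≤ _ := by gcongr

end Ratios

section Criterion

open IntermediateField

lemma exists_finite_ratios_of_algebraic {n : ℕ} {α : ℝ}
    (hind : LinearIndependent ℚ (fun i : Fin (n + 1) => α ^ (i : ℕ)))
    (halg : IsAlgebraic ℚ α) (hdeg : (minpoly ℚ α).natDegree = n + 1) :
    ∃ F : Set ℝ, F.Finite ∧ ∀ m : ℕ, 1 ≤ m → ∀ A : Matrix (Fin (n + 1)) (Fin (n + 1)) ℤ,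
      IsMinkowskiMatrix (fun i : Fin n => α ^ (n - (i : ℕ))) m A → ∀ i j,
      xi (fun i : Fin n => α ^ (n - (i : ℕ))) (A i) /
        xi (fun i : Fin n => α ^ (n - (i : ℕ))) (A j) ∈ F := by
  have hfd : FiniteDimensional ℚ ℚ⟮α⟯ := adjoin.finiteDimensional halg.isIntegral
  have hnf : NumberField ℚ⟮α⟯ := { to_charZero := inferInstance, to_finiteDimensional := hfd }
  have hrank : Module.finrank ℚ ℚ⟮α⟯ = n + 1 := by
    rw [adjoin.finrank halg.isIntegral, hdeg]
  set θ : ℚ⟮α⟯ := AdjoinSimple.gen ℚ α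
  have hθα : algebraMap ℚ⟮α⟯ ℝ θ = α := AdjoinSimple.algebraMap_gen ℚ α
  set τ : ℚ⟮α⟯ →ₐ[ℚ] ℂ :=
    (Complex.ofRealHom.comp (algebraMap ℚ⟮α⟯ ℝ)).toRatAlgHom
  have hτnorm : ∀ z, ‖τ z‖ = |algebraMap ℚ⟮α⟯ ℝ z| := fun z => Complex.norm_real _
  obtain ⟨a, ha0, haθ⟩ : ∃ a : ℤ, a ≠ 0 ∧ IsIntegral ℤ (a • θ) :=
    ((IsFractionRing.isAlgebraic_iff ℤ ℚ ℚ⟮α⟯).2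
      (Algebra.IsAlgebraic.isAlgebraic θ)).exists_integral_multiple
  obtain ⟨C₀, hC₀, hbound⟩ := exists_abs_xi_le_of_algebraic hind halg hdeg
  set b : (Fin (n + 1) → ℤ) → ℚ⟮α⟯ :=
    fun w => a ^ n * ∑ i : Fin (n + 1), (w i : ℚ⟮α⟯) * θ ^ (n - (i : ℕ)) with hb
  have hbα : ∀ w, algebraMap ℚ⟮α⟯ ℝ (b w) =
      a ^ n * xi (fun i : Fin n => α ^ (n - (i : ℕ))) w := by
    intro w
    simp only [hb, xi_powers_eq_sum, map_mul, map_pow, map_sum, map_intCast, hθα]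
  have hbint : ∀ w, IsIntegral ℤ (b w) := by
    intro w
    have h1 : b w = ∑ i : Fin (n + 1),
        algebraMap ℤ ℚ⟮α⟯ (w i * a ^ (i : ℕ)) * (a • θ) ^ (n - (i : ℕ)) := by
      simp only [hb, Finset.mul_sum]
      refine Finset.sum_congr rfl fun i _ => ?_
      have h2 : (a : ℚ⟮α⟯) ^ n = a ^ (i : ℕ) * a ^ (n - (i : ℕ)) := by
        rw [← pow_add]
        congr 1
        have := i.2
        omega
      rw [h2, zsmul_eq_mul, mul_pow, eq_intCast]
      push_cast
      ring
    rw [h1]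
    exact IsIntegral.sum _ fun i _ => isIntegral_algebraMap.mul (haθ.pow _)
  set T : ℝ := ∑ σ : ℚ⟮α⟯ →ₐ[ℚ] ℂ, ∑ i : Fin (n + 1), ‖σ θ‖ ^ (n - (i : ℕ)) with hT
  have hT0 : 0 ≤ T := by positivity
  have ha : (0 : ℝ) < |(a : ℝ)| ^ n := pow_pos (abs_pos.2 (by exact_mod_cast ha0)) n
  have hconj : ∀ (m : ℕ) (w : Fin (n + 1) → ℤ), (∀ k, |w k| ≤ (m : ℤ)) →
      ∀ σ : ℚ⟮α⟯ →ₐ[ℚ] ℂ, ‖σ (b w)‖ ≤ |(a : ℝ)| ^ n * (C₀ + T) * m := by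
    intro m w hw σ
    have h1 : ‖∑ i : Fin (n + 1), (w i : ℂ) * σ θ ^ (n - (i : ℕ))‖ ≤ m * T := by
      calc ‖∑ i : Fin (n + 1), (w i : ℂ) * σ θ ^ (n - (i : ℕ))‖
          ≤ ∑ i : Fin (n + 1), m * ‖σ θ‖ ^ (n - (i : ℕ)) := by
            refine (norm_sum_le _ _).trans (Finset.sum_le_sum fun i _ => ?_)
            rw [norm_mul, norm_pow, Complex.norm_intCast]
            gcongr
            exact_mod_cast hw i
        _ = m * ∑ i : Fin (n + 1), ‖σ θ‖ ^ (n - (i : ℕ)) := by rw [Finset.mul_sum]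
        _ ≤ m * T := by
            gcongr
            exact Finset.single_le_sum
              (f := fun σ : ℚ⟮α⟯ →ₐ[ℚ] ℂ => ∑ i : Fin (n + 1), ‖σ θ‖ ^ (n - (i : ℕ)))
              (fun _ _ => by positivity) (Finset.mem_univ σ)
    simp only [hb, map_mul, map_pow, map_sum, map_intCast, norm_mul, norm_pow,
      Complex.norm_intCast]
    rw [mul_assoc]
    refine mul_le_mul_of_nonneg_left (h1.trans ?_) ha.le
    have : 0 ≤ C₀ * (m : ℝ) := by positivity
    linarith
  refine ⟨_, (finite_quotients_of_norm_le τ hrank (|(a : ℝ)| ^ n * (C₀ + T))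
    (by positivity)).image (algebraMap ℚ⟮α⟯ ℝ), fun m hm A hA i j => ?_⟩
  have hm0 : (0 : ℝ) < m := by exact_mod_cast hm
  have hrow : ∀ l, ‖τ (b (A l))‖ ≤ |(a : ℝ)| ^ n * (C₀ + T) / (m : ℝ) ^ n ∧
      ∀ σ : ℚ⟮α⟯ →ₐ[ℚ] ℂ, ‖σ (b (A l))‖ ≤ |(a : ℝ)| ^ n * (C₀ + T) * m := by
    refine fun l => ⟨?_, hconj m _ (hA l).1⟩
    rw [hτnorm, hbα, abs_mul, abs_pow, mul_div_assoc]
    refine mul_le_mul_of_nonneg_left ((hbound m hm A hA l).trans ?_) ha.le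
    gcongr
    linarith
  have ha' : (a : ℝ) ^ n ≠ 0 := pow_ne_zero _ (by exact_mod_cast ha0)
  have hbj : b (A j) ≠ 0 := by
    intro h
    have h1 := hbα (A j)
    rw [h, map_zero] at h1
    exact mul_ne_zero ha' (xi_powers_ne_zero hind (hA.row_ne_zero j)) h1.symm
  refine ⟨b (A i) / b (A j), ⟨m, b (A j), b (A i), hm0, hbj, hbint _, hbint _, hrow j, hrow i,
    rfl⟩, ?_⟩
  rw [map_div₀, hbα, hbα, mul_div_mul_left _ _ ha']

lemma exists_abs_xi_row_zero_le {n : ℕ} (α : ℝ) :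
    ∃ C : ℝ, 0 < C ∧ ∀ m : ℕ, 1 ≤ m → ∀ A : Matrix (Fin (n + 1)) (Fin (n + 1)) ℤ,
      IsMinkowskiMatrix (fun i : Fin n => α ^ (n - (i : ℕ))) m A →
      |xi (fun i : Fin n => α ^ (n - (i : ℕ))) (A 0)| ≤ C / (m : ℝ) ^ n := by
  obtain ⟨C, hC, h⟩ := exists_small_linear_form (fun k : Fin (n + 1) => α ^ (n - (k : ℕ)))
  refine ⟨C, hC, fun m hm A hA => ?_⟩
  obtain ⟨w, hw0, hwm, hw⟩ := h m hm
  refine ((hA 0).2.2.1 w hwm (notMem_earlierRowSpan_zero A hw0)).trans ?_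
  rwa [xi_powers_eq_sum]

/-- Two Minkowski matrices acting in the same way on `(αⁿ, …, α)` are proportional over `ℚ`,
unless `α` is algebraic of degree `n + 1`. -/
lemma proportional_or_algebraic_of_projAct_eq {n : ℕ} {α : ℝ}
    (hind : LinearIndependent ℚ (fun i : Fin (n + 1) => α ^ (i : ℕ)))
    {A A' : Matrix (Fin (n + 1)) (Fin (n + 1)) ℤ} {m m' : ℕ}
    (hA : IsMinkowskiMatrix (fun i : Fin n => α ^ (n - (i : ℕ))) m A)
    (hA' : IsMinkowskiMatrix (fun i : Fin n => α ^ (n - (i : ℕ))) m' A')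
    (h : projAct A (fun i : Fin n => α ^ (n - (i : ℕ))) =
      projAct A' (fun i : Fin n => α ^ (n - (i : ℕ)))) :
    (∃ c d : ℤ, d ≠ 0 ∧ d • A' = c • A) ∨
      (IsAlgebraic ℚ α ∧ (minpoly ℚ α).natDegree = n + 1) := by
  have hdet := det_ne_zero_of_notMem_earlierRowSpan fun j => (hA j).2.1
  set x : Fin n → ℝ := fun i => α ^ (n - (i : ℕ)) with hx
  set s := xi x (A (Fin.last n)) with hs
  set t := xi x (A' (Fin.last n)) with ht
  have hs0 : s ≠ 0 := xi_powers_ne_zero hind (hA.row_ne_zero _)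
  have ht0 : t ≠ 0 := xi_powers_ne_zero hind (hA'.row_ne_zero _)
  have hrow : ∀ i, xi x (A' i) = t / s * xi x (A i) := by
    intro i
    refine Fin.lastCases ?_ (fun i => ?_) i
    · rw [← hs, ← ht]
      field_simp
    · have h1 := congrFun h i
      rw [projAct_apply_eq_div, projAct_apply_eq_div, ← hs, ← ht, div_eq_div_iff hs0 ht0] at h1
      field_simp
      linarith
  set R := A.adjugate * A' with hR
  have hlin : ∀ (M N : Matrix (Fin (n + 1)) (Fin (n + 1)) ℤ) (i : Fin (n + 1)),
      xi x ((M * N) i) = ∑ k, (M i k : ℝ) * xi x (N k) := by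
    intro M N i
    simp only [hx, xi_powers_eq_sum, Matrix.mul_apply, Int.cast_sum, Int.cast_mul,
      Finset.mul_sum, Finset.sum_mul]
    rw [Finset.sum_comm]
    simp only [mul_assoc]
  have heig : ∀ i, xi x (R i) = (t / s * A.det) * α ^ (n - (i : ℕ)) := by
    intro i
    have h1 : xi x (R i) = t / s * xi x ((A.adjugate * A) i) := by
      rw [hR, hlin, hlin, Finset.mul_sum]
      exact Finset.sum_congr rfl fun k _ => by rw [hrow]; ring
    rw [h1, Matrix.adjugate_mul, hx, xi_powers_eq_sum, mul_assoc]
    congr 1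
    simp [Matrix.one_apply]
  refine (scalar_or_algebraic_of_eigenvector hind R _ heig).imp_left ?_
  rintro ⟨c, hc⟩
  refine ⟨c, A.det, hdet, ?_⟩
  have h1 : A * R = A.det • A' := by
    rw [hR, ← mul_assoc, Matrix.mul_adjugate, Matrix.smul_mul, one_mul]
  rw [← h1, hc, Matrix.scalar_apply, ← Matrix.smul_one_eq_diagonal, Matrix.mul_smul, mul_one]

end Criterion

/-- Minkowski's criterion: if `{αⁿ, α^{n-1}, …, α, 1}` are linearly independent over `ℚ`
and `B` is the Minkowski chain for `(αⁿ, …, α)`, then `α` is algebraic of degree `ℓ = n+1`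
over `ℚ` if and only if the sequence of `n`-tuples `B_k(αⁿ, …, α)` takes only finitely many
distinct values. -/
theorem minkowski_algebraic_criterion {n : ℕ} (hn : 1 ≤ n) (α : ℝ)
    (hind : LinearIndependent ℚ (fun i : Fin (n + 1) => α ^ (i : ℕ)))
    (B : ℕ → Matrix (Fin (n + 1)) (Fin (n + 1)) ℤ)
    (hB : IsMinkowskiChain (fun i : Fin n => α ^ (n - (i : ℕ))) B) :
    (IsAlgebraic ℚ α ∧ (minpoly ℚ α).natDegree = n + 1) ↔
      (Set.range fun k => projAct (B k) (fun i : Fin n => α ^ (n - (i : ℕ)))).Finite := by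
  obtain ⟨A, idx, hA, hmono, hidx0, hBA, -, -⟩ := hB
  have hidx : ∀ k, 1 ≤ idx k := fun k => hidx0 ▸ hmono.monotone (Nat.zero_le k)
  have hBk : ∀ k, IsMinkowskiMatrix (fun i : Fin n => α ^ (n - (i : ℕ))) (idx k) (B k) :=
    fun k => hBA k ▸ hA _ (hidx k)
  constructor
  · rintro ⟨halg, hdeg⟩
    obtain ⟨F, hF, hmem⟩ := exists_finite_ratios_of_algebraic hind halg hdeg
    refine (Set.Finite.pi' (fun _ : Fin n => hF)).subset ?_
    rintro _ ⟨k, rfl⟩ i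
    simp only [projAct_apply_eq_div]
    exact hmem _ (hidx k) _ (hBk k) _ _
  · intro hfin
    by_contra hcon
    have := hfin.to_subtype
    obtain ⟨y, hy⟩ := Finite.exists_infinite_fiber (Set.rangeFactorization
      fun k => projAct (B k) (fun i : Fin n => α ^ (n - (i : ℕ))))
    have hinf := Set.infinite_coe_iff.1 hy
    obtain ⟨j, hj⟩ := hinf.nonempty
    have hval : ∀ k ∈ Set.rangeFactorization (fun k => projAct (B k)
        (fun i : Fin n => α ^ (n - (i : ℕ)))) ⁻¹' {y},
        projAct (B k) (fun i : Fin n => α ^ (n - (i : ℕ))) = y.1 :=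
      fun k hk => congrArg Subtype.val hk
    obtain ⟨C, hC, hsmall⟩ := exists_abs_xi_row_zero_le (n := n) α
    set β := xi (fun i : Fin n => α ^ (n - (i : ℕ))) (B j 0) with hβ
    have hβ0 : 0 < |β| := abs_pos.2 (xi_powers_ne_zero hind ((hBk j).row_ne_zero 0))
    obtain ⟨k₀, hk₀⟩ := exists_nat_gt (C * idx j / |β|)
    obtain ⟨k, hk, hkk⟩ := hinf.exists_gt k₀
    obtain ⟨c, d, hd, hcd⟩ := (proportional_or_algebraic_of_projAct_eq hind (hBk j) (hBk k)
      ((hval j hj).trans (hval k hk).symm)).resolve_right hcon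
    have hent : ∀ l, d * B k 0 l = c * B j 0 l := by
      intro l
      have := congrFun (congrFun hcd 0) l
      simpa using this
    obtain ⟨l, hl, -⟩ := (hBk k 0).2.2.2
    have h1 : |d| ≤ |c| * idx j := by
      calc |d| = |d| * 1 := (mul_one _).symm
        _ ≤ |d| * |B k 0 l| := by
            gcongr
            exact Int.one_le_abs hl.ne'
        _ = |c| * |B j 0 l| := by rw [← abs_mul, hent, abs_mul]
        _ ≤ |c| * idx j := by
            gcongr
            exact (hBk j 0).1 l
    have h2 : d * xi (fun i : Fin n => α ^ (n - (i : ℕ))) (B k 0) = c * β := by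
      rw [hβ, xi_powers_eq_sum, xi_powers_eq_sum, Finset.mul_sum, Finset.mul_sum]
      refine Finset.sum_congr rfl fun l _ => ?_
      have : (d : ℝ) * B k 0 l = c * B j 0 l := by exact_mod_cast hent l
      rw [← mul_assoc, this, mul_assoc]
    set γ := xi (fun i : Fin n => α ^ (n - (i : ℕ))) (B k 0) with hγ
    have h3 : |γ| ≤ C / (idx k : ℝ) := by
      have hk1 : (1 : ℝ) ≤ idx k := by exact_mod_cast hidx k
      refine (hsmall _ (hidx k) _ (hBk k)).trans ?_
      gcongr
      exact le_self_pow₀ hk1 (by omega)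
    have hd0 : (0 : ℝ) < |(d : ℝ)| := abs_pos.2 (by exact_mod_cast hd)
    have h1' : |(d : ℝ)| ≤ |(c : ℝ)| * idx j := by exact_mod_cast h1
    have h4 : |(d : ℝ)| * |γ| = |(c : ℝ)| * |β| := by rw [← abs_mul, h2, abs_mul]
    have h5 : |β| ≤ idx j * |γ| := by
      refine le_of_mul_le_mul_left ?_ hd0
      calc |(d : ℝ)| * |β| ≤ (|(c : ℝ)| * idx j) * |β| := by gcongr
        _ = idx j * (|(c : ℝ)| * |β|) := by ring
        _ = |(d : ℝ)| * (idx j * |γ|) := by rw [← h4]; ring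
    have hk2 : (0 : ℝ) < idx k := by exact_mod_cast hidx k
    have h6 : (k₀ : ℝ) ≤ idx k := by exact_mod_cast hkk.le.trans (hmono.le_apply)
    have h7 : |β| * idx k ≤ C * idx j := by
      calc |β| * idx k ≤ (idx j * (C / idx k)) * idx k := by
            gcongr
            exact h5.trans (by gcongr)
        _ = C * idx j := by field_simp
    rw [div_lt_iff₀ hβ0] at hk₀
    nlinarith
end

section
/- Suppose {α_1, …, α_n, 1} are linearly independent over ℚ. If L_α is badly approximable then there is a constant c > 0 such that there are infinitely many matrices A ∈ GL(ℓ, ℤ) with ‖A(α_1, …, α_n, 1)ᵀ‖_∞ < c ‖A‖_∞^{-n}. -/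
/-- The distance from a real number to the nearest integer. -/
noncomputable def distNearestInt (t : ℝ) : ℝ := |t - round t|

/-- The linear form L_α(q) = α₁q₁ + ⋯ + αₙqₙ. -/
noncomputable def Lform {n : ℕ} (α : Fin n → ℝ) (q : Fin n → ℤ) : ℝ :=
  ∑ i, α i * (q i : ℝ)

/-- The sup norm of an integer vector. -/
def intSupNorm {n : ℕ} (q : Fin n → ℤ) : ℕ := Finset.univ.sup fun i => (q i).natAbs

/-- The form L_α is badly approximable: there is `c > 0` with
`‖L_α(q)‖ ≥ c ‖q‖_∞^{-n}` for all nonzero integer vectors `q`. -/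
def BadlyApprox {n : ℕ} (α : Fin n → ℝ) : Prop :=
  ∃ c > (0 : ℝ), ∀ q : Fin n → ℤ, q ≠ 0 →
    c / (intSupNorm q : ℝ) ^ n ≤ distNearestInt (Lform α q)

/-- The form L_α is singular: for every `ε > 0` and all sufficiently large integers `Q`
there is a nonzero `q ∈ ℤⁿ` with `‖q‖_∞ ≤ Q` and `‖L_α(q)‖ ≤ ε Q^{-n}`. -/
def Singular {n : ℕ} (α : Fin n → ℝ) : Prop :=
  ∀ ε > (0 : ℝ), ∃ Q₀ : ℕ, ∀ Q : ℕ, Q₀ ≤ Q → ∃ q : Fin n → ℤ, q ≠ 0 ∧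
    (intSupNorm q : ℝ) ≤ (Q : ℝ) ∧ distNearestInt (Lform α q) ≤ ε / (Q : ℝ) ^ n

/-- The sup norm of a square integer matrix (maximum of the absolute values of the
entries). -/
def matSupNorm {l : ℕ} (A : Matrix (Fin l) (Fin l) ℤ) : ℕ :=
  Finset.univ.sup fun i => Finset.univ.sup fun j => (A i j).natAbs

open Matrix

/-- The value at an integer vector of the quadratic form with Gram matrix `G`. -/
def quadVal {ι : Type*} [Fintype ι] (G : Matrix ι ι ℝ) (x : ι → ℤ) : ℝ :=
  ∑ i, ∑ j, G i j * x i * x j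

/-- The Schur complement of the upper left entry of `G`. -/
noncomputable def schurCorner {k : ℕ} (G : Matrix (Fin (k + 1)) (Fin (k + 1)) ℝ) :
    Matrix (Fin k) (Fin k) ℝ :=
  Matrix.of fun i j => G i.succ j.succ - G i.succ 0 * G 0 j.succ / G 0 0

/-- Bordering `A` by the first unit row and the first column `t`. -/
def borderMatrix {k : ℕ} (t : Fin k → ℤ) (A : Matrix (Fin k) (Fin k) ℤ) :
    Matrix (Fin (k + 1)) (Fin (k + 1)) ℤ :=
  Matrix.of (Fin.cons (Pi.single 0 1) fun i => Fin.cons (t i) (A i))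

lemma quadVal_eq_dotProduct {ι : Type*} [Fintype ι] (G : Matrix ι ι ℝ) (x : ι → ℤ) :
    quadVal G x = (fun i => (x i : ℝ)) ⬝ᵥ G *ᵥ (fun i => (x i : ℝ)) := by
  simp only [quadVal, dotProduct, mulVec, Finset.mul_sum]
  exact Finset.sum_congr rfl fun i _ => Finset.sum_congr rfl fun j _ => by ring

lemma quadVal_mul_transpose {ι : Type*} [Fintype ι] (M : Matrix ι ι ℝ) (x : ι → ℤ) :
    quadVal (M * Mᵀ) x = ∑ j, ((fun i => (x i : ℝ)) ᵥ* M) j ^ 2 := by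
  rw [quadVal_eq_dotProduct, ← mulVec_mulVec, dotProduct_mulVec, mulVec_transpose]
  simp only [dotProduct, pow_two]

lemma quadVal_conj {ι : Type*} [Fintype ι] (G : Matrix ι ι ℝ) (A : Matrix ι ι ℤ) (x : ι → ℤ) :
    quadVal (A.map (Int.cast : ℤ → ℝ) * G * (A.map (Int.cast : ℤ → ℝ))ᵀ) x
      = quadVal G (x ᵥ* A) := by
  have h : (fun i => ((x ᵥ* A) i : ℝ)) = (fun i => (x i : ℝ)) ᵥ* A.map (Int.cast : ℤ → ℝ) := by
    ext i
    simp [vecMul, dotProduct]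
  rw [quadVal_eq_dotProduct, quadVal_eq_dotProduct, h, ← mulVec_mulVec, ← mulVec_mulVec,
    dotProduct_mulVec, mulVec_transpose]

lemma quadVal_single_zero {k : ℕ} (G : Matrix (Fin (k + 1)) (Fin (k + 1)) ℝ) :
    quadVal G (Pi.single 0 1) = G 0 0 := by
  simp [quadVal, Pi.single_apply]

lemma quadVal_cons {k : ℕ} {G : Matrix (Fin (k + 1)) (Fin (k + 1)) ℝ} (hG : G.IsSymm)
    (h0 : G 0 0 ≠ 0) (t : ℤ) (a : Fin k → ℤ) :
    quadVal G (Fin.cons t a : Fin (k + 1) → ℤ) = quadVal (schurCorner G) a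
      + G 0 0 * (t + (∑ i, G 0 i.succ * a i) / G 0 0) ^ 2 := by
  have hs : ∀ i : Fin k, G i.succ 0 = G 0 i.succ := fun i => hG.apply _ _
  have hsq : ∑ i, ∑ j, G 0 i.succ * G 0 j.succ / G 0 0 * (a i : ℝ) * a j
      = (∑ i, G 0 i.succ * (a i : ℝ)) ^ 2 / G 0 0 := by
    rw [pow_two, Finset.sum_mul_sum, Finset.sum_div]
    refine Finset.sum_congr rfl fun i _ => ?_
    rw [Finset.sum_div]
    exact Finset.sum_congr rfl fun j _ => by ring
  have hS : quadVal (schurCorner G) a = ∑ i, ∑ j, G i.succ j.succ * (a i : ℝ) * a j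
      - (∑ i, G 0 i.succ * (a i : ℝ)) ^ 2 / G 0 0 := by
    rw [← hsq, ← Finset.sum_sub_distrib]
    refine Finset.sum_congr rfl fun i _ => ?_
    rw [← Finset.sum_sub_distrib]
    refine Finset.sum_congr rfl fun j _ => ?_
    simp only [schurCorner, of_apply, hs]
    ring
  have h1 : ∑ j : Fin k, G 0 j.succ * (t : ℝ) * a j = t * ∑ i, G 0 i.succ * (a i : ℝ) := by
    rw [Finset.mul_sum]
    exact Finset.sum_congr rfl fun j _ => by ring
  have h2 : ∑ j : Fin k, G 0 j.succ * (a j : ℝ) * t = t * ∑ i, G 0 i.succ * (a i : ℝ) := by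
    rw [Finset.mul_sum]
    exact Finset.sum_congr rfl fun j _ => by ring
  rw [hS]
  simp only [quadVal, Fin.sum_univ_succ, Fin.cons_zero, Fin.cons_succ, Finset.sum_add_distrib,
    hs, h1, h2]
  field_simp
  ring

lemma det_eq_mul_det_schurCorner {k : ℕ} (G : Matrix (Fin (k + 1)) (Fin (k + 1)) ℝ)
    (h0 : G 0 0 ≠ 0) : G.det = G 0 0 * (schurCorner G).det := by
  let c : Fin (k + 1) → ℝ := Fin.cons 0 fun i => -(G i.succ 0 / G 0 0)
  let H : Matrix (Fin (k + 1)) (Fin (k + 1)) ℝ := Matrix.of fun i j => G i j + c i * G 0 j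
  have hdet : H.det = G.det :=
    det_eq_of_forall_row_eq_smul_add_const c 0 (by simp [c]) fun i j => rfl
  have hcol : ∀ i : Fin k, H i.succ 0 = 0 := fun i => by
    simp only [H, c, of_apply, Fin.cons_succ]
    field_simp
    ring
  have hsub : H.submatrix Fin.succ Fin.succ = schurCorner G := by
    ext i j
    simp only [H, c, of_apply, Fin.cons_succ, submatrix_apply, schurCorner]
    ring
  have h00 : H 0 0 = G 0 0 := by simp [H, c]
  rw [← hdet, det_succ_column_zero, Fin.sum_univ_succ]
  simp only [hcol, mul_zero, zero_mul, Finset.sum_const_zero, add_zero]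
  rw [show H.submatrix (Fin.succAbove 0) Fin.succ = schurCorner G from by
    rw [← hsub, Fin.succAbove_zero], h00]
  simp

lemma schurCorner_isSymm {k : ℕ} {G : Matrix (Fin (k + 1)) (Fin (k + 1)) ℝ} (hG : G.IsSymm) :
    (schurCorner G).IsSymm := by
  ext i j
  simp only [transpose_apply, schurCorner, of_apply]
  rw [hG.apply i.succ j.succ, hG.apply 0 j.succ, hG.apply i.succ 0, mul_comm]

lemma borderMatrix_zero {k : ℕ} (t : Fin k → ℤ) (A : Matrix (Fin k) (Fin k) ℤ) :
    borderMatrix t A 0 = Pi.single 0 1 := rfl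

lemma borderMatrix_succ {k : ℕ} (t : Fin k → ℤ) (A : Matrix (Fin k) (Fin k) ℤ) (i : Fin k) :
    borderMatrix t A i.succ = (Fin.cons (t i) (A i) : Fin (k + 1) → ℤ) := rfl

lemma det_borderMatrix {k : ℕ} (t : Fin k → ℤ) (A : Matrix (Fin k) (Fin k) ℤ) :
    (borderMatrix t A).det = A.det := by
  rw [det_succ_row_zero, Fin.sum_univ_succ]
  have h : (borderMatrix t A).submatrix Fin.succ (Fin.succAbove 0) = A := by
    ext i j
    simp [borderMatrix]
  rw [h]
  simp [borderMatrix_zero]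

/-- A choice of the bordering column makes the rows size-reduced with respect to the first
one. -/
lemma exists_border_quadVal_le {k : ℕ} {G : Matrix (Fin (k + 1)) (Fin (k + 1)) ℝ}
    (hG : G.IsSymm) (h0 : 0 < G 0 0) (A : Matrix (Fin k) (Fin k) ℤ) :
    ∃ t : Fin k → ℤ, ∀ i : Fin k,
      quadVal G (borderMatrix t A i.succ) ≤ quadVal (schurCorner G) (A i) + G 0 0 / 4 := by
  refine ⟨fun i => -round ((∑ j, G 0 j.succ * (A i j : ℝ)) / G 0 0), fun i => ?_⟩
  rw [borderMatrix_succ, quadVal_cons hG h0.ne']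
  set s := (∑ j, G 0 j.succ * (A i j : ℝ)) / G 0 0
  have hr := abs_le.mp (abs_sub_round s)
  have : (((-round s : ℤ) : ℝ) + s) ^ 2 ≤ 1 / 4 := by
    push_cast
    nlinarith
  nlinarith

/-- Hermite reduction: a quadratic form of bounded determinant whose values on rows of
unimodular matrices are bounded away from `0` has a basis with bounded values. -/
theorem exists_unimodular_quadVal_le (k : ℕ) : ∀ δ D : ℝ, 0 < δ → ∃ C : ℝ,
    ∀ G : Matrix (Fin (k + 1)) (Fin (k + 1)) ℝ, G.IsSymm → G.det ≤ D →
      (∀ A : Matrix (Fin (k + 1)) (Fin (k + 1)) ℤ, IsUnit A.det → ∀ i, δ ≤ quadVal G (A i)) →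
      ∃ A : Matrix (Fin (k + 1)) (Fin (k + 1)) ℤ, IsUnit A.det ∧ ∀ i, quadVal G (A i) ≤ C := by
  induction k with
  | zero =>
    intro δ D _
    refine ⟨D, fun G _ hD _ => ⟨1, by simp, fun i => ?_⟩⟩
    have h : G 0 0 ≤ D := (det_fin_one G).ge.trans hD
    obtain rfl : i = 0 := Fin.eq_zero i
    simpa [quadVal] using h
  | succ k ih =>
    intro δ D hδ
    obtain ⟨C, hC⟩ := ih (δ / 4) (|D| / δ) (by positivity)
    refine ⟨4 * C, fun G hG hD hlow => ?_⟩
    obtain ⟨A₀, hA₀, hA₀min⟩ : ∃ A₀ : Matrix (Fin (k + 2)) (Fin (k + 2)) ℤ, IsUnit A₀.det ∧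
        ∀ A : Matrix (Fin (k + 2)) (Fin (k + 2)) ℤ, IsUnit A.det →
          ∀ i, quadVal G (A₀ 0) / 2 ≤ quadVal G (A i) := by
      let V : Set ℝ := {v | ∃ A : Matrix (Fin (k + 2)) (Fin (k + 2)) ℤ,
        IsUnit A.det ∧ ∃ i, quadVal G (A i) = v}
      have hV : ∀ v ∈ V, δ ≤ v := by
        rintro v ⟨A, hA, i, rfl⟩
        exact hlow A hA i
      have hVne : V.Nonempty := ⟨_, 1, by simp, 0, rfl⟩
      have hpos : 0 < sInf V := hδ.trans_le (le_csInf hVne hV)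
      obtain ⟨v, ⟨A, hA, i, rfl⟩, hv⟩ :=
        exists_lt_of_csInf_lt hVne (show sInf V < 2 * sInf V by linarith)
      refine ⟨A.submatrix (Equiv.swap 0 i) id, ?_, fun A' hA' i' => ?_⟩
      · rw [det_permute]
        exact (Units.isUnit _).mul hA
      · have hrow : A.submatrix (Equiv.swap 0 i) id 0 = A i := by
          ext j
          simp
        have : sInf V ≤ quadVal G (A' i') := csInf_le ⟨δ, hV⟩ ⟨A', hA', i', rfl⟩
        rw [hrow]
        linarith
    let P := A₀.map (Int.cast : ℤ → ℝ)
    let G' := P * G * Pᵀ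
    have hval : ∀ (A : Matrix (Fin (k + 2)) (Fin (k + 2)) ℤ) (i : Fin (k + 2)),
        quadVal G' (A i) = quadVal G ((A * A₀) i) := fun A i => quadVal_conj G A₀ (A i)
    have h00 : G' 0 0 = quadVal G (A₀ 0) := by
      rw [← quadVal_single_zero G', show quadVal G' (Pi.single 0 1) = _ from quadVal_conj G A₀ _]
      simp [row]
    have hmin : ∀ A : Matrix (Fin (k + 2)) (Fin (k + 2)) ℤ, IsUnit A.det →
        ∀ i, G' 0 0 / 2 ≤ quadVal G' (A i) := fun A hA i => by
      rw [hval, h00]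
      exact hA₀min _ (by rw [det_mul]; exact hA.mul hA₀) i
    have hm : δ ≤ G' 0 0 := h00 ▸ hlow A₀ hA₀ 0
    have hm0 : 0 < G' 0 0 := hδ.trans_le hm
    have hG' : G'.IsSymm := by
      simp only [G', IsSymm, transpose_mul, transpose_transpose, hG.eq, Matrix.mul_assoc]
    have hdet : G'.det = G.det := by
      have hP : P.det = (A₀.det : ℝ) := by
        simpa [P] using (Int.cast_det (R := ℝ) A₀).symm
      have : (A₀.det : ℝ) * A₀.det = 1 := by
        exact_mod_cast Int.isUnit_mul_self hA₀
      rw [det_mul, det_mul, det_transpose, hP]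
      linear_combination G.det * this
    have hdetS : (schurCorner G').det ≤ |D| / δ := by
      have h1 := det_eq_mul_det_schurCorner G' hm0.ne'
      rw [le_div_iff₀ hδ]
      by_contra! hlt
      have h2 : 0 < (schurCorner G').det := by
        by_contra! h
        nlinarith [abs_nonneg D]
      nlinarith [le_abs_self D]
    obtain ⟨A, hA, hAC⟩ := hC _ (schurCorner_isSymm hG') hdetS fun A hA i => by
      obtain ⟨t, ht⟩ := exists_border_quadVal_le hG' hm0 A
      have := hmin (borderMatrix t A) (by rwa [det_borderMatrix]) i.succ
      linarith [ht i]
    obtain ⟨t, ht⟩ := exists_border_quadVal_le hG' hm0 A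
    have hB : IsUnit (borderMatrix t A).det := by rwa [det_borderMatrix]
    have hmC : G' 0 0 ≤ 4 * C := by
      linarith [hmin _ hB (Fin.succ 0), ht 0, hAC 0]
    refine ⟨borderMatrix t A * A₀, by rw [det_mul]; exact hB.mul hA₀, fun i => ?_⟩
    rw [← hval]
    refine Fin.cases ?_ (fun i => ?_) i
    · rw [borderMatrix_zero, quadVal_single_zero]
      exact hmC
    · linarith [ht i, hAC i]

/-- The rows of this matrix generate the lattice of all `(q / Q, Q ^ n * ξ(q, p))`. -/
noncomputable def dualLattice {n : ℕ} (α : Fin n → ℝ) (Q : ℝ) :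
    Matrix (Fin (n + 1)) (Fin (n + 1)) ℝ :=
  Matrix.of fun i j =>
    Fin.lastCases (Q ^ n * (Fin.snoc α 1 : Fin (n + 1) → ℝ) i)
      (fun j' => if i = Fin.castSucc j' then Q⁻¹ else 0) j

lemma det_dualLattice {n : ℕ} (α : Fin n → ℝ) {Q : ℝ} (hQ : Q ≠ 0) :
    (dualLattice α Q).det = 1 := by
  rw [det_of_isUpperTriangular]
  · rw [Fin.prod_univ_castSucc]
    simp [dualLattice, hQ]
  · intro i j hij
    change j < i at hij
    induction j using Fin.lastCases with
    | last => exact absurd hij (Fin.le_last i).not_gt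
    | cast j => simp [dualLattice, hij.ne']

lemma quadVal_dualLattice {n : ℕ} (α : Fin n → ℝ) (Q : ℝ) (r : Fin (n + 1) → ℤ) :
    quadVal (dualLattice α Q * (dualLattice α Q)ᵀ) r
      = ∑ i : Fin n, ((r i.castSucc : ℝ) / Q) ^ 2 + (Q ^ n * xi α r) ^ 2 := by
  rw [quadVal_mul_transpose, Fin.sum_univ_castSucc]
  congr 1
  · refine Finset.sum_congr rfl fun j _ => ?_
    simp [vecMul, dotProduct, dualLattice, div_eq_mul_inv]
  · congr 1
    simp only [vecMul, dotProduct, dualLattice, of_apply, Fin.lastCases_last,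
      Fin.sum_univ_castSucc, Fin.snoc_castSucc, Fin.snoc_last, xi, mul_add, Finset.mul_sum]
    rw [add_comm]
    congr 1
    · ring
    · exact Finset.sum_congr rfl fun j _ => by ring

lemma distNearestInt_le_abs_xi {n : ℕ} (α : Fin n → ℝ) (r : Fin (n + 1) → ℤ) :
    distNearestInt (Lform α fun i => r i.castSucc) ≤ |xi α r| := by
  have h := round_le (Lform α fun i => r i.castSucc) (-r (Fin.last n))
  rw [distNearestInt]
  refine h.trans_eq ?_
  simp only [xi, Lform]
  push_cast
  congr 1
  ring

lemma intSupNorm_pos {n : ℕ} {q : Fin n → ℤ} (hq : q ≠ 0) : 0 < intSupNorm q := by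
  obtain ⟨i, hi⟩ := Function.ne_iff.mp hq
  exact (Int.natAbs_pos.mpr hi).trans_le
    (Finset.le_sup (f := fun i => (q i).natAbs) (Finset.mem_univ i))

lemma one_le_abs_xi {n : ℕ} (α : Fin n → ℝ) {r : Fin (n + 1) → ℤ} (hr : r ≠ 0)
    (hq : (fun i : Fin n => r i.castSucc) = 0) : 1 ≤ |xi α r| := by
  have hz : ∀ i : Fin n, r i.castSucc = 0 := fun i => congrFun hq i
  have hp : r (Fin.last n) ≠ 0 := fun h => hr <| by
    ext i
    exact Fin.lastCases h hz i
  simp only [xi, hz, Int.cast_zero, mul_zero, Finset.sum_const_zero, add_zero]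
  exact_mod_cast Int.one_le_abs hp

lemma xi_ne_zero {n : ℕ} {α : Fin n → ℝ} (hba : BadlyApprox α) {r : Fin (n + 1) → ℤ}
    (hr : r ≠ 0) : xi α r ≠ 0 := by
  rw [← abs_pos]
  by_cases hq : (fun i : Fin n => r i.castSucc) = 0
  · exact zero_lt_one.trans_le (one_le_abs_xi α hr hq)
  · obtain ⟨c, hc, h⟩ := hba
    have hN : (0 : ℝ) < intSupNorm (fun i : Fin n => r i.castSucc) :=
      Nat.cast_pos.mpr (intSupNorm_pos hq)
    exact (by positivity : 0 < c / _).trans_le ((h _ hq).trans (distNearestInt_le_abs_xi α r))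

lemma BadlyApprox.exists_le_quadVal {n : ℕ} {α : Fin n → ℝ} (hba : BadlyApprox α) :
    ∃ δ > (0 : ℝ), ∀ Q : ℝ, 1 ≤ Q → ∀ r : Fin (n + 1) → ℤ, r ≠ 0 →
      δ ≤ quadVal (dualLattice α Q * (dualLattice α Q)ᵀ) r := by
  obtain ⟨c, hc, h⟩ := hba
  refine ⟨min 1 (c ^ 2), by positivity, fun Q hQ r hr => ?_⟩
  rw [quadVal_dualLattice]
  have hQ0 : 0 < Q := zero_lt_one.trans_le hQ
  have hQn : 1 ≤ Q ^ n := one_le_pow₀ hQ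
  have hsum : 0 ≤ ∑ i : Fin n, ((r i.castSucc : ℝ) / Q) ^ 2 :=
    Finset.sum_nonneg fun i _ => sq_nonneg _
  have key : ∀ d : ℝ, 0 ≤ d → d ≤ Q ^ n * |xi α r| → d ^ 2 ≤ (Q ^ n * xi α r) ^ 2 := by
    intro d hd hle
    calc d ^ 2 ≤ (Q ^ n * |xi α r|) ^ 2 := by gcongr
      _ = (Q ^ n * xi α r) ^ 2 := by rw [mul_pow, mul_pow, sq_abs]
  by_cases hq : (fun i : Fin n => r i.castSucc) = 0
  · have := key 1 zero_le_one (one_le_mul_of_one_le_of_one_le hQn (one_le_abs_xi α hr hq))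
    linarith [min_le_left 1 (c ^ 2)]
  · have hN := intSupNorm_pos hq
    by_cases hNQ : (intSupNorm (fun i : Fin n => r i.castSucc) : ℝ) ≤ Q
    · have hNpos : (0 : ℝ) < intSupNorm (fun i : Fin n => r i.castSucc) := Nat.cast_pos.mpr hN
      have hξ := (h _ hq).trans (distNearestInt_le_abs_xi α r)
      have := key c hc.le <| calc
        c = Q ^ n * (c / Q ^ n) := by field_simp
        _ ≤ Q ^ n * (c / (intSupNorm (fun i : Fin n => r i.castSucc) : ℝ) ^ n) := by gcongr
        _ ≤ Q ^ n * |xi α r| := by gcongr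
      linarith [min_le_right 1 (c ^ 2)]
    · obtain ⟨i, hi⟩ : ∃ i : Fin n, Q < ((r i.castSucc).natAbs : ℝ) := by
        by_contra! hcon
        refine hNQ ((Nat.cast_le.mpr (Finset.sup_le fun i _ =>
          Nat.le_floor (hcon i))).trans (Nat.floor_le hQ0.le))
      have h1 : 1 ≤ ((r i.castSucc : ℝ) / Q) ^ 2 := by
        rw [← sq_abs, abs_div, abs_of_pos hQ0]
        refine one_le_pow₀ ((one_le_div hQ0).mpr ?_)
        rw [Nat.cast_natAbs, Int.cast_abs] at hi
        exact hi.le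
      have h2 := Finset.single_le_sum (f := fun i : Fin n => ((r i.castSucc : ℝ) / Q) ^ 2)
        (fun i _ => sq_nonneg _) (Finset.mem_univ i)
      have h3 := min_le_left 1 (c ^ 2)
      have h4 := sq_nonneg (Q ^ n * xi α r)
      linarith

lemma row_ne_zero_of_isUnit_det {l : ℕ} {A : Matrix (Fin l) (Fin l) ℤ} (hA : IsUnit A.det)
    (i : Fin l) : A i ≠ 0 := fun h =>
  hA.ne_zero (det_eq_zero_of_row_eq_zero i fun j => congrFun h j)

lemma natAbs_le_matSupNorm {l : ℕ} (A : Matrix (Fin l) (Fin l) ℤ) (i j : Fin l) :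
    (A i j).natAbs ≤ matSupNorm A :=
  (Finset.le_sup (f := fun j => (A i j).natAbs) (Finset.mem_univ j)).trans
    (Finset.le_sup (f := fun i => Finset.univ.sup fun j => (A i j).natAbs) (Finset.mem_univ i))

lemma matSupNorm_pos {n : ℕ} {A : Matrix (Fin (n + 1)) (Fin (n + 1)) ℤ} (hA : IsUnit A.det) :
    0 < matSupNorm A := by
  obtain ⟨j, hj⟩ := Function.ne_iff.mp (row_ne_zero_of_isUnit_det hA 0)
  exact (Int.natAbs_pos.mpr hj).trans_le (natAbs_le_matSupNorm A 0 j)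

lemma matSupNorm_le {l : ℕ} {A : Matrix (Fin l) (Fin l) ℤ} {R : ℝ} (hR : 0 ≤ R)
    (h : ∀ i j, |(A i j : ℝ)| ≤ R) : (matSupNorm A : ℝ) ≤ R := by
  refine (Nat.cast_le.mpr (Finset.sup_le fun i _ => Finset.sup_le fun j _ =>
    Nat.le_floor ?_)).trans (Nat.floor_le hR)
  rw [Nat.cast_natAbs, Int.cast_abs]
  exact h i j

/-- For a badly approximable form there are, at every scale `Q`, unimodular matrices of
norm `O(Q)` whose rows have `ξ`-values `O(Q ^ (-n))`. -/
theorem BadlyApprox.exists_unimodular {n : ℕ} {α : Fin n → ℝ} (hba : BadlyApprox α) :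
    ∃ K > (0 : ℝ), ∀ Q : ℝ, 1 ≤ Q → ∃ A : Matrix (Fin (n + 1)) (Fin (n + 1)) ℤ,
      IsUnit A.det ∧ (matSupNorm A : ℝ) ≤ K * Q ∧ ∀ i, |xi α (A i)| ≤ K / Q ^ n := by
  obtain ⟨δ, hδ, hlow⟩ := hba.exists_le_quadVal
  obtain ⟨C, hC⟩ := exists_unimodular_quadVal_le n δ 1 hδ
  set s := ∑ i, |α i| with hs
  have hs0 : 0 ≤ s := Finset.sum_nonneg fun i _ => abs_nonneg _
  set B := √C + 1 with hB
  have hB0 : 0 < B := by positivity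
  refine ⟨B * (1 + s), by positivity, fun Q hQ => ?_⟩
  have hQ0 : 0 < Q := zero_lt_one.trans_le hQ
  have hQn : 1 ≤ Q ^ n := one_le_pow₀ hQ
  obtain ⟨A, hA, hAC⟩ := hC (dualLattice α Q * (dualLattice α Q)ᵀ) (isSymm_mul_transpose_self _)
    (by simp [det_dualLattice α hQ0.ne']) fun A hA i => hlow Q hQ _ (row_ne_zero_of_isUnit_det hA i)
  have hbound : ∀ x : ℝ, x ^ 2 ≤ C → |x| ≤ B := fun x hx =>
    (Real.abs_le_sqrt hx).trans (by linarith)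
  have hxi : ∀ i, |xi α (A i)| ≤ B / Q ^ n := fun i => by
    have h := hAC i
    rw [quadVal_dualLattice] at h
    have hsum : 0 ≤ ∑ j : Fin n, ((A i j.castSucc : ℝ) / Q) ^ 2 :=
      Finset.sum_nonneg fun j _ => sq_nonneg _
    have := hbound (Q ^ n * xi α (A i)) (by linarith)
    rw [abs_mul, abs_of_pos (zero_lt_one.trans_le hQn)] at this
    rwa [le_div_iff₀' (zero_lt_one.trans_le hQn)]
  have hq : ∀ i (j : Fin n), |(A i j.castSucc : ℝ)| ≤ B * Q := fun i j => by
    have h := hAC i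
    rw [quadVal_dualLattice] at h
    have h2 := Finset.single_le_sum (f := fun j : Fin n => ((A i j.castSucc : ℝ) / Q) ^ 2)
      (fun j _ => sq_nonneg _) (Finset.mem_univ j)
    have h4 := sq_nonneg (Q ^ n * xi α (A i))
    have := hbound ((A i j.castSucc : ℝ) / Q) (by linarith)
    rwa [abs_div, abs_of_pos hQ0, div_le_iff₀ hQ0] at this
  refine ⟨A, hA, matSupNorm_le (by positivity) fun i j => ?_, fun i => (hxi i).trans ?_⟩
  · induction j using Fin.lastCases with
    | cast j =>
      refine (hq i j).trans ?_
      nlinarith [mul_nonneg (mul_nonneg hB0.le hs0) hQ0.le]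
    | last =>
      have hp : (A i (Fin.last n) : ℝ)
          = xi α (A i) - ∑ j : Fin n, α j * (A i j.castSucc : ℝ) := by
        simp [xi]
      have hL : |∑ j : Fin n, α j * (A i j.castSucc : ℝ)| ≤ s * (B * Q) := by
        rw [hs, Finset.sum_mul]
        refine (Finset.abs_sum_le_sum_abs _ _).trans (Finset.sum_le_sum fun j _ => ?_)
        rw [abs_mul]
        exact mul_le_mul_of_nonneg_left (hq i j) (abs_nonneg _)
      have hx : |xi α (A i)| ≤ B * Q :=
        (hxi i).trans ((div_le_self hB0.le hQn).trans (le_mul_of_one_le_right hB0.le hQ))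
      rw [hp]
      refine (abs_sub _ _).trans ?_
      linarith
  · gcongr
    exact le_mul_of_one_le_right hB0.le (by linarith)

/-- Suppose `{α₁, …, αₙ, 1}` are linearly independent over `ℚ`. If `L_α` is badly
approximable, then there is `c > 0` such that there are infinitely many `A ∈ GL(ℓ, ℤ)`
with `‖A(α₁, …, αₙ, 1)ᵀ‖_∞ < c ‖A‖_∞^{-n}`. -/
theorem infinitely_many_good_unimodular {n : ℕ} (hn : 1 ≤ n) (α : Fin n → ℝ)
    (hind : LinearIndependent ℚ (Fin.snoc α 1 : Fin (n + 1) → ℝ))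
    (hba : BadlyApprox α) :
    ∃ c > (0 : ℝ),
      {A : Matrix (Fin (n + 1)) (Fin (n + 1)) ℤ | IsUnit A.det ∧
        ∀ i : Fin (n + 1), |xi α (A i)| < c / (matSupNorm A : ℝ) ^ n}.Infinite := by
  obtain ⟨K, hK, hA⟩ := hba.exists_unimodular
  refine ⟨K * K ^ n + 1, by positivity, fun hfin => ?_⟩
  have hmem : ∀ Q : ℝ, 1 ≤ Q → ∃ A : Matrix (Fin (n + 1)) (Fin (n + 1)) ℤ, (IsUnit A.det ∧
      ∀ i, |xi α (A i)| < (K * K ^ n + 1) / (matSupNorm A : ℝ) ^ n) ∧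
        |xi α (A 0)| ≤ K / Q ^ n := by
    intro Q hQ
    obtain ⟨A, hdet, hnorm, hxi⟩ := hA Q hQ
    have hQ0 : 0 < Q := zero_lt_one.trans_le hQ
    have hN : (0 : ℝ) < matSupNorm A := Nat.cast_pos.mpr (matSupNorm_pos hdet)
    refine ⟨A, ⟨hdet, fun i => (hxi i).trans_lt ?_⟩, hxi 0⟩
    calc K / Q ^ n = K * K ^ n / (K * Q) ^ n := by
          rw [mul_pow]
          field_simp
      _ ≤ K * K ^ n / (matSupNorm A : ℝ) ^ n := by gcongr
      _ < (K * K ^ n + 1) / (matSupNorm A : ℝ) ^ n := by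
          gcongr
          linarith
  obtain ⟨A₁, hA₁, -⟩ := hmem 1 le_rfl
  obtain ⟨A₀, hA₀, hmin⟩ := Set.exists_min_image _
    (fun A : Matrix (Fin (n + 1)) (Fin (n + 1)) ℤ => |xi α (A 0)|) hfin ⟨A₁, hA₁⟩
  have hpos : 0 < |xi α (A₀ 0)| :=
    abs_pos.mpr (xi_ne_zero hba (row_ne_zero_of_isUnit_det hA₀.1 0))
  set Q := K / |xi α (A₀ 0)| + 1 with hQ
  have hQ1 : 1 ≤ Q := by
    have : 0 < K / |xi α (A₀ 0)| := by positivity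
    linarith
  obtain ⟨A, hAmem, hAQ⟩ := hmem Q hQ1
  have h1 : |xi α (A₀ 0)| ≤ K / Q ^ n := (hmin A hAmem).trans hAQ
  have h2 : K / Q ^ n ≤ K / Q := by
    gcongr
    exact le_self_pow₀ hQ1 (by omega)
  have h3 : K / Q < |xi α (A₀ 0)| := by
    rw [div_lt_comm₀ (by linarith) hpos, hQ]
    linarith
  linarith
end

section
/- Suppose p/q < p'/q' is a pair of consecutive fractions in the Farey set F_m and α ∈ (p/q, p'/q') is irrational. Then the mediant (p+p')/(q+q') is the unique fraction with the smallest denominator greater than m that is closer to α than at least one of p/q and p'/q'; that is, (p+p')/(q+q') is closer to α than at least one of p/q, p'/q', and every other fraction p''/q'' with m < q'' ≤ q+q' satisfies |α − p''/q''| > |α − (p+p')/(q+q')|. -/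
/-- The fractions `p / q` and `p' / q'` of a Farey pair satisfy `p' q - p q' = 1`, and their
mediant has denominator larger than `m`. -/
theorem IsFareyPair.det_eq_one_and_lt_add {m : ℕ} {p q p' q' : ℤ} (hq : 0 < q) (hq' : 0 < q')
    (hcop : IsCoprime p q) (hcop' : IsCoprime p' q')
    (h : IsFareyPair m ((p : ℚ) / (q : ℚ)) ((p' : ℚ) / (q' : ℚ))) :
    p' * q - p * q' = 1 ∧ (m : ℤ) < q + q' ∧ q ≤ m ∧ q' ≤ m := by
  obtain ⟨hlt, h0, h1, hd, hd', hno⟩ := h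
  have hqQ : (0 : ℚ) < q := by exact_mod_cast hq
  have hqQ' : (0 : ℚ) < q' := by exact_mod_cast hq'
  have hqm : q ≤ m := by
    rw [← Rat.den_div_eq_of_coprime hq (Int.isCoprime_iff_nat_coprime.mp hcop)]
    exact_mod_cast hd
  have hqm' : q' ≤ m := by
    rw [← Rat.den_div_eq_of_coprime hq' (Int.isCoprime_iff_nat_coprime.mp hcop')]
    exact_mod_cast hd'
  have hD : 0 < p' * q - p * q' := by
    rw [div_lt_div_iff₀ hqQ hqQ'] at hlt
    have : p * q' < p' * q := by exact_mod_cast hlt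
    linarith
  obtain ⟨x, y, hxy, hym, hmy⟩ : ∃ x y : ℤ, q * x - p * y = 1 ∧ y ≤ m ∧ m < q + y := by
    obtain ⟨u, v, huv⟩ := hcop
    refine ⟨v + p * ((m + u) / q), -u + q * ((m + u) / q), by linear_combination huv, ?_, ?_⟩
    · linarith [Int.mul_ediv_add_emod (m + u) q, Int.emod_nonneg (m + u) hq.ne']
    · linarith [Int.mul_ediv_add_emod (m + u) q, Int.emod_lt_of_pos (m + u) hq]
  have hy : 0 < y := by linarith
  have hyQ : (0 : ℚ) < y := by exact_mod_cast hy
  have hsum : q' = q * (x * q' - p' * y) + y * (p' * q - p * q') := by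
    linear_combination -q' * hxy
  rcases lt_trichotomy (x * q' - p' * y) 0 with hA | hA | hA
  · exfalso
    have hleft : (p : ℚ) / q < x / y := by
      rw [div_lt_div_iff₀ hqQ hyQ]
      have : p * y < x * q := by linarith
      exact_mod_cast this
    have hright : (x : ℚ) / y < p' / q' := by
      rw [div_lt_div_iff₀ hyQ hqQ']
      have : x * q' < p' * y := by linarith
      exact_mod_cast this
    refine hno (x / y) (h0.trans hleft.le) (hright.le.trans h1) ?_ ⟨hleft, hright⟩
    have hc : IsCoprime x y := ⟨q, -p, by linear_combination hxy⟩
    have := Rat.den_div_eq_of_coprime hy (Int.isCoprime_iff_nat_coprime.mp hc)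
    exact_mod_cast this.trans_le hym
  · have hunit : IsUnit (p' * q - p * q') := hcop'.isUnit_of_dvd'
      ⟨x, by linear_combination -p' * hxy + p * hA⟩ ⟨y, by linear_combination hsum + q * hA⟩
    have hone : p' * q - p * q' = 1 := by
      rcases Int.isUnit_iff.mp hunit with h | h <;> linarith
    rw [hone, hA] at hsum
    exact ⟨hone, by linarith, hqm, hqm'⟩
  · exfalso
    nlinarith [mul_le_mul_of_nonneg_left (Int.add_one_le_iff.mpr hA) hq.le,
      mul_le_mul_of_nonneg_left (Int.add_one_le_iff.mpr hD) hy.le]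

/-- If `p / q` and `p' / q'` have determinant one, a fraction whose denominator exceeds `q` and
`q'` but not `q + q'` is either their mediant or lies strictly outside `[p / q, p' / q']`. -/
theorem eq_mediant_or_outside {p q p' q' r s : ℤ} (hq : 0 < q) (hq' : 0 < q')
    (hdet : p' * q - p * q' = 1) (hcop : IsCoprime r s) (hqs : q < s) (hqs' : q' < s)
    (hs : s ≤ q + q') :
    (r = p + p' ∧ s = q + q') ∨ r * q - p * s < 0 ∨ p' * s - r * q' < 0 := by
  have hsEq : s = q * (p' * s - r * q') + q' * (r * q - p * s) := by
    linear_combination -s * hdet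
  have hrEq : r = p * (p' * s - r * q') + p' * (r * q - p * s) := by
    linear_combination -r * hdet
  generalize p' * s - r * q' = b at *
  generalize r * q - p * s = a at *
  rcases lt_trichotomy a 0 with ha | rfl | ha
  · exact .inr (.inl ha)
  · have hb : IsUnit b := hcop.isUnit_of_dvd' ⟨p, by linarith⟩ ⟨q, by linarith⟩
    rcases Int.isUnit_iff.mp hb with rfl | rfl <;> linarith
  rcases lt_trichotomy b 0 with hb | rfl | hb
  · exact .inr (.inr hb)
  · have ha : IsUnit a := hcop.isUnit_of_dvd' ⟨p', by linarith⟩ ⟨q', by linarith⟩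
    rcases Int.isUnit_iff.mp ha with rfl | rfl <;> linarith
  · have hb1 : b = 1 := by nlinarith
    have ha1 : a = 1 := by nlinarith
    subst hb1 ha1
    exact .inl ⟨by linarith, by linarith⟩

/-- Suppose `p/q < p'/q'` are consecutive fractions in the Farey set `F_m` and
`α ∈ (p/q, p'/q')` is irrational. Then the mediant `(p+p')/(q+q')` is closer to `α` than
at least one of `p/q`, `p'/q'`, and every other fraction `p''/q''` (in lowest terms) with
`m < q'' ≤ q + q'` is strictly farther from `α` than the mediant. -/
theorem mediant_is_best_new_approximation
    (m : ℕ) (hm : 1 ≤ m) (p q p' q' : ℤ) (hq : 0 < q) (hq' : 0 < q')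
    (hcop : IsCoprime p q) (hcop' : IsCoprime p' q')
    (hfarey : IsFareyPair m ((p : ℚ) / (q : ℚ)) ((p' : ℚ) / (q' : ℚ)))
    (α : ℝ) (hirr : Irrational α)
    (h1 : (p : ℝ) / (q : ℝ) < α) (h2 : α < (p' : ℝ) / (q' : ℝ)) :
    (|α - ((p : ℝ) + (p' : ℝ)) / ((q : ℝ) + (q' : ℝ))| < |α - (p : ℝ) / (q : ℝ)| ∨
      |α - ((p : ℝ) + (p' : ℝ)) / ((q : ℝ) + (q' : ℝ))| < |α - (p' : ℝ) / (q' : ℝ)|) ∧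
    ∀ p'' q'' : ℤ, 0 < q'' → IsCoprime p'' q'' → (m : ℤ) < q'' → q'' ≤ q + q' →
      (p'' : ℚ) / (q'' : ℚ) ≠ ((p : ℚ) + (p' : ℚ)) / ((q : ℚ) + (q' : ℚ)) →
      |α - ((p : ℝ) + (p' : ℝ)) / ((q : ℝ) + (q' : ℝ))| < |α - (p'' : ℝ) / (q'' : ℝ)| := by
  obtain ⟨hdet, hm', hqm, hqm'⟩ := hfarey.det_eq_one_and_lt_add hq hq' hcop hcop'
  have hqR : (0 : ℝ) < q := by exact_mod_cast hq
  have hqR' : (0 : ℝ) < q' := by exact_mod_cast hq'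
  have hdetR : (p' : ℝ) * q - p * q' = 1 := by exact_mod_cast hdet
  have hleft : ((p : ℝ) + p') / (q + q') - p / q = 1 / (q * (q + q')) := by
    field_simp
    linear_combination hdetR
  have hright : (p' : ℝ) / q' - (p + p') / (q + q') = 1 / (q' * (q + q')) := by
    field_simp
    linear_combination hdetR
  have hleft_pos : 0 < 1 / ((q : ℝ) * (q + q')) := by positivity
  have hright_pos : 0 < 1 / ((q' : ℝ) * (q + q')) := by positivity
  refine ⟨?_, fun r s hs hrs hms hsle hne => ?_⟩
  · rcases le_total (((p : ℝ) + p') / (q + q')) α with h | h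
    · left
      rw [abs_of_nonneg (by linarith), abs_of_pos (by linarith)]
      linarith
    · right
      rw [abs_of_nonpos (by linarith), abs_of_neg (by linarith)]
      linarith
  have hsR : (0 : ℝ) < s := by exact_mod_cast hs
  have hsleR : (s : ℝ) ≤ q + q' := by exact_mod_cast hsle
  rcases eq_mediant_or_outside hq hq' hdet hrs (by linarith) (by linarith) hsle with
    ⟨rfl, rfl⟩ | h | h
  · exact absurd (by push_cast; rfl) hne
  · have hgap : 1 / ((q : ℝ) * (q + q')) ≤ p / q - r / s := by
      have hint : (1 : ℝ) ≤ p * s - q * r := by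
        have : 1 ≤ p * s - q * r := by linarith
        exact_mod_cast this
      rw [div_sub_div _ _ hqR.ne' hsR.ne']
      gcongr
    rw [abs_of_pos (by linarith : 0 < α - r / s), abs_lt]
    constructor <;> linarith
  · have hgap : 1 / ((q' : ℝ) * (q + q')) ≤ r / s - p' / q' := by
      have hint : (1 : ℝ) ≤ r * q' - s * p' := by
        have : 1 ≤ r * q' - s * p' := by linarith
        exact_mod_cast this
      rw [div_sub_div _ _ hsR.ne' hqR'.ne', mul_comm (s : ℝ) q']
      gcongr
    rw [abs_of_neg (by linarith : α - r / s < 0), abs_lt]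
    constructor <;> linarith
end

section
/- Fix m ∈ ℤ⁺ and suppose r_1, …, r_ℓ ∈ ℤ^ℓ are linearly independent, satisfy ‖r_i‖_∞ ≤ m for i = 1, …, ℓ, and are ordered so that |ξ(r_1)| ≤ |ξ(r_2)| ≤ ⋯ ≤ |ξ(r_ℓ)|. Then for each i = 1, …, ℓ one has |β_i(m)| ≤ |ξ(r_i)|. -/
/-- The span of the rows preceding row `i` has dimension at most `i`. -/
theorem finrank_earlierRowSpan_le {n : ℕ} (A : Matrix (Fin (n + 1)) (Fin (n + 1)) ℤ)
    (i : Fin (n + 1)) : Module.finrank ℝ (earlierRowSpan A i) ≤ i := by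
  have h : {x : Fin (n + 1) → ℝ | ∃ j : Fin (n + 1), j < i ∧ x = fun k => (A j k : ℝ)} =
      Set.range fun (j : Set.Iio i) k => (A j k : ℝ) := by
    ext x
    simp [eq_comm]
  unfold earlierRowSpan
  rw [h]
  refine (finrank_range_le_card _).trans ?_
  simp

/-- Among the first `i + 1` vectors of a linearly independent family, one lies outside the span
of the rows of `A` preceding row `i`. -/
theorem exists_notMem_earlierRowSpan {n : ℕ} (A : Matrix (Fin (n + 1)) (Fin (n + 1)) ℤ)
    {v : Fin (n + 1) → Fin (n + 1) → ℝ} (hv : LinearIndependent ℝ v) (i : Fin (n + 1)) :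
    ∃ j ≤ i, v j ∉ earlierRowSpan A i := by
  by_contra! h
  have hv' : LinearIndependent ℝ fun j : Set.Iic i => v j :=
    hv.comp _ Subtype.val_injective
  have hle : Submodule.span ℝ (Set.range fun j : Set.Iic i => v j) ≤ earlierRowSpan A i := by
    rw [Submodule.span_le]
    rintro _ ⟨j, rfl⟩
    exact h j j.2
  have hdim := (Submodule.finrank_mono hle).trans (finrank_earlierRowSpan_le A i)
  rw [finrank_span_eq_card hv'] at hdim
  simp at hdim

/-- Fix `m ≥ 1` and let `A` be the matrix from the Minkowski algorithm at stage `m`, with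
`β_i(m) = ξ(i-th row of A)`. If `r₁, …, r_ℓ ∈ ℤ^ℓ` are linearly independent with
`‖r_i‖_∞ ≤ m`, ordered so that `|ξ(r₁)| ≤ ⋯ ≤ |ξ(r_ℓ)|`, then `|β_i(m)| ≤ |ξ(r_i)|` for
each `i`. -/
theorem minkowski_rows_minimize {n : ℕ} (α : Fin n → ℝ)
    (hind : LinearIndependent ℚ (Fin.snoc α 1 : Fin (n + 1) → ℝ))
    (m : ℕ) (hm : 1 ≤ m)
    (A : Matrix (Fin (n + 1)) (Fin (n + 1)) ℤ) (hA : IsMinkowskiMatrix α m A)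
    (r : Fin (n + 1) → Fin (n + 1) → ℤ)
    (hli : LinearIndependent ℝ (fun i => fun k => ((r i k : ℝ))))
    (hbd : ∀ i k, |r i k| ≤ (m : ℤ))
    (hord : ∀ i j : Fin (n + 1), i ≤ j → |xi α (r i)| ≤ |xi α (r j)|) :
    ∀ i : Fin (n + 1), |xi α (A i)| ≤ |xi α (r i)| := by
  intro i
  obtain ⟨j, hji, hj⟩ := exists_notMem_earlierRowSpan A hli i
  exact ((hA i).2.2.1 (r j) (hbd j) hj).trans (hord j i hji)
end
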